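/- There exists a constant C > 0, independent of the solution and of S, T, such that every classical solution of system (S) satisfies the integral observability inequality ∫_S^T E(t) dt ≤ C E(S) for every 0 ≤ S ≤ T. -/

import Mathlib

open Set MeasureTheory

/-- A classical solution of system (S): a wave equation with localized in-domain damping and
Wentzell (dynamic) boundary conditions. -/
structure ClassicalSolutionS (a q : ℝ → ℝ) (α₁ α₂ β₁ γ₁ μ₁ : ℝ) where
  u : ℝ → ℝ → ℝ
  ut : ℝ → ℝ → ℝ
  ux : ℝ → ℝ → ℝ
  utt : ℝ → ℝ → ℝ
  dAux : ℝ → ℝ → ℝ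
  η₁ : ℝ → ℝ
  η₂ : ℝ → ℝ
  ζ₁ : ℝ → ℝ
  hu_t : ∀ t ∈ Ici (0:ℝ), ∀ x ∈ Icc (0:ℝ) 1, HasDerivAt (fun s => u s x) (ut t x) t
  hu_x : ∀ t ∈ Ici (0:ℝ), ∀ x ∈ Icc (0:ℝ) 1, HasDerivAt (fun y => u t y) (ux t x) x
  hut_C1 : ContDiffOn ℝ 1 (fun p : ℝ × ℝ => ut p.1 p.2) (Ici (0:ℝ) ×ˢ Icc (0:ℝ) 1)
  hux_C1 : ContDiffOn ℝ 1 (fun p : ℝ × ℝ => ux p.1 p.2) (Ici (0:ℝ) ×ˢ Icc (0:ℝ) 1)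
  hu_tt : ∀ t ∈ Ici (0:ℝ), ∀ x ∈ Icc (0:ℝ) 1, HasDerivAt (fun s => ut s x) (utt t x) t
  haux_lip : ∀ t ∈ Ici (0:ℝ),
      ∃ K : NNReal, LipschitzOnWith K (fun x => a x * ux t x) (Icc (0:ℝ) 1)
  haux : ∀ t ∈ Ici (0:ℝ), ∀ᵐ x ∂(volume.restrict (Ioo (0:ℝ) 1)),
      HasDerivAt (fun y => a y * ux t y) (dAux t x) x
  hPDE : ∀ t ∈ Ici (0:ℝ), ∀ᵐ x ∂(volume.restrict (Ioo (0:ℝ) 1)),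
      utt t x - dAux t x = - q x * ut t x
  hbc1 : ∀ t ∈ Ici (0:ℝ), ut t 1 = η₁ t
  hbc0 : ∀ t ∈ Ici (0:ℝ), ut t 0 = ζ₁ t
  hη₁C1 : ContDiffOn ℝ 1 η₁ (Ici (0:ℝ))
  hη₂C1 : ContDiffOn ℝ 1 η₂ (Ici (0:ℝ))
  hζ₁C1 : ContDiffOn ℝ 1 ζ₁ (Ici (0:ℝ))
  hode1 : ∀ t ∈ Ici (0:ℝ), HasDerivAt η₁ (-α₁ * η₁ t - α₂ * η₂ t - β₁ * ux t 1) t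
  hode2 : ∀ t ∈ Ici (0:ℝ), HasDerivAt η₂ (η₁ t) t
  hode3 : ∀ t ∈ Ici (0:ℝ), HasDerivAt ζ₁ (-γ₁ * ζ₁ t + μ₁ * ux t 0) t

/-- The energy of a classical solution of system (S). -/
noncomputable def energyS {a q : ℝ → ℝ} {α₁ α₂ β₁ γ₁ μ₁ : ℝ}
    (sol : ClassicalSolutionS a q α₁ α₂ β₁ γ₁ μ₁) (t : ℝ) : ℝ :=
  (1/2) * (∫ x in (0:ℝ)..1, (sol.ut t x ^ 2 + a x * sol.ux t x ^ 2))
    + (a 1 / (2 * β₁)) * sol.η₁ t ^ 2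
    + (a 1 * α₂ / (2 * β₁)) * sol.η₂ t ^ 2
    + (a 0 / (2 * μ₁)) * sol.ζ₁ t ^ 2

/-- Assumption (A1): `a` is Lipschitz on `[0,1]` and bounded below and above by positive
constants `a_min ≤ a_max`. -/
def AssumptionA1 (a : ℝ → ℝ) (a_min a_max : ℝ) : Prop :=
  (∃ K : NNReal, LipschitzOnWith K a (Icc (0:ℝ) 1)) ∧ 0 < a_min ∧ a_min ≤ a_max ∧
    ∀ x ∈ Icc (0:ℝ) 1, a_min ≤ a x ∧ a x ≤ a_max

/-- Assumption (A2'): `q` is bounded measurable, nonnegative a.e., and bounded below by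
`q_min > 0` a.e. on the interval `(1-ε₃, 1)`. -/
def AssumptionA2' (q : ℝ → ℝ) (ε₃ q_min : ℝ) : Prop :=
  Measurable q ∧ (∃ Q : ℝ, ∀ x ∈ Icc (0:ℝ) 1, |q x| ≤ Q) ∧
    (∀ᵐ x ∂(volume.restrict (Ioo (0:ℝ) 1)), 0 ≤ q x) ∧
    0 < ε₃ ∧ ε₃ < 1 ∧ 0 < q_min ∧
    ∀ᵐ x ∂(volume.restrict (Ioo (1 - ε₃) 1)), q_min ≤ q x

open Filter Topology
open scoped Interval

/-- The fundamental theorem of calculus for absolutely continuous functions, in terms of an almost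
everywhere derivative on the open interval. -/
theorem AbsolutelyContinuousOnInterval.intervalIntegrable_and_integral_eq_sub_of_ae_hasDerivAt
    {f f' : ℝ → ℝ} {a b : ℝ} (hab : a ≤ b) (hf : AbsolutelyContinuousOnInterval f a b)
    (h : ∀ᵐ x ∂(volume.restrict (Ioo a b)), HasDerivAt f (f' x) x) :
    IntervalIntegrable f' volume a b ∧ ∫ x in a..b, f' x = f b - f a := by
  have h' : deriv f =ᵐ[volume.restrict (Ι a b)] f' := by
    rw [uIoc_of_le hab, ← restrict_Ioo_eq_restrict_Ioc]
    exact h.mono fun x hx => hx.deriv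
  refine ⟨hf.intervalIntegrable_deriv.congr_ae h', ?_⟩
  rw [← hf.integral_deriv_eq_sub]
  exact (intervalIntegral.integral_congr_ae_restrict h').symm

theorem intervalIntegral_mono_of_ae_Ioo {f g : ℝ → ℝ} {a b : ℝ} (hab : a ≤ b)
    (hf : IntervalIntegrable f volume a b) (hg : IntervalIntegrable g volume a b)
    (h : ∀ᵐ x ∂(volume.restrict (Ioo a b)), f x ≤ g x) :
    ∫ x in a..b, f x ≤ ∫ x in a..b, g x := by
  refine intervalIntegral.integral_mono_ae_restrict hab hf hg ?_
  rwa [← restrict_Ioo_eq_restrict_Icc]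

theorem sq_intervalIntegral_le {f : ℝ → ℝ} {a b : ℝ} (hab : a ≤ b) (hb : b ≤ a + 1)
    (hf : IntervalIntegrable f volume a b)
    (hf2 : IntervalIntegrable (fun x => f x ^ 2) volume a b) :
    (∫ x in a..b, f x) ^ 2 ≤ ∫ x in a..b, f x ^ 2 := by
  set m := ∫ x in a..b, f x with hm
  have h0 : 0 ≤ ∫ x in a..b, (f x ^ 2 - 2 * m * f x + m ^ 2) := by
    refine intervalIntegral.integral_nonneg hab fun x _ => ?_
    nlinarith [sq_nonneg (f x - m)]
  rw [intervalIntegral.integral_add (hf2.sub (hf.const_mul _)) intervalIntegrable_const,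
    intervalIntegral.integral_sub hf2 (hf.const_mul _), intervalIntegral.integral_const_mul,
    intervalIntegral.integral_const, ← hm, smul_eq_mul] at h0
  nlinarith [sq_nonneg m]

/-- The functions `v = u_t`, `p = u_x`, `z = u_tt`, `y = u_tx` at a fixed time. -/
structure SpatialSlice (a q v p z y : ℝ → ℝ) : Prop where
  cont_v : ContinuousOn v (Icc 0 1)
  cont_p : ContinuousOn p (Icc 0 1)
  cont_z : ContinuousOn z (Icc 0 1)
  cont_y : ContinuousOn y (Icc 0 1)
  deriv_v : ∀ x ∈ Ioo (0:ℝ) 1, HasDerivAt v (y x) x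
  ac_v : AbsolutelyContinuousOnInterval v 0 1
  ac_flux : AbsolutelyContinuousOnInterval (fun x => a x * p x) 0 1
  deriv_flux : ∀ᵐ x ∂(volume.restrict (Ioo (0:ℝ) 1)),
    HasDerivAt (fun x => a x * p x) (z x + q x * v x) x

theorem AssumptionA1.continuousOn {a : ℝ → ℝ} {a_min a_max : ℝ} (h : AssumptionA1 a a_min a_max) :
    ContinuousOn a (Icc 0 1) := h.1.choose_spec.continuousOn

theorem AssumptionA1.absolutelyContinuous {a : ℝ → ℝ} {a_min a_max : ℝ}
    (h : AssumptionA1 a a_min a_max) : AbsolutelyContinuousOnInterval a 0 1 := by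
  obtain ⟨⟨K, hK⟩, -⟩ := h
  exact LipschitzOnWith.absolutelyContinuousOnInterval (K := K) (by simpa using hK)

theorem AssumptionA1.ae_hasDerivAt {a : ℝ → ℝ} {a_min a_max : ℝ}
    (h : AssumptionA1 a a_min a_max) :
    ∃ K, 0 ≤ K ∧ ∀ᵐ x ∂(volume.restrict (Ioo (0:ℝ) 1)),
      HasDerivAt a (deriv a x) x ∧ |deriv a x| ≤ K := by
  obtain ⟨K, hK⟩ := h.1
  refine ⟨K, K.2, ?_⟩
  rw [ae_restrict_iff' measurableSet_Ioo]
  filter_upwards [h.absolutelyContinuous.ae_differentiableAt] with x hx hxI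
  exact ⟨(hx (by simpa using Ioo_subset_Icc_self hxI)).hasDerivAt,
    norm_deriv_le_of_lipschitzOn (Icc_mem_nhds hxI.1 hxI.2) hK⟩

section Damping

variable {q : ℝ → ℝ} {ε₃ q_min : ℝ}

theorem AssumptionA2'.intervalIntegrable (h : AssumptionA2' q ε₃ q_min) :
    IntervalIntegrable q volume 0 1 := by
  obtain ⟨hm, ⟨Q, hQ⟩, -⟩ := h
  have : IntervalIntegrable (fun _ : ℝ => Q) volume 0 1 := by simp
  refine this.mono_fun' hm.aestronglyMeasurable ?_
  rw [uIoc_of_le zero_le_one, EventuallyLE, ae_restrict_iff' measurableSet_Ioc]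
  exact ae_of_all _ fun x hx => hQ x (Ioc_subset_Icc_self hx)

/-- Pointwise bounds on the damping, including the comparison with a ramp supported in
`[1 - ε₃, 1]`. -/
theorem AssumptionA2'.ae_bounds (h : AssumptionA2' q ε₃ q_min) :
    ∃ Q > 0, ∀ᵐ x ∂(volume.restrict (Ioo (0:ℝ) 1)),
      0 ≤ q x ∧ q x ≤ Q ∧ (1 - ε₃ < x → q_min ≤ q x) ∧ q_min * max (x - (1 - ε₃)) 0 ≤ q x := by
  obtain ⟨hm, ⟨Q, hQ⟩, h0, he, he1, hq, hlow⟩ := h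
  refine ⟨|Q| + 1, by positivity, ?_⟩
  rw [ae_restrict_iff' measurableSet_Ioo] at h0 hlow ⊢
  filter_upwards [h0, hlow] with x hx0 hxl hx
  have h1 := hx0 hx
  refine ⟨h1, ?_, fun hxr => hxl ⟨hxr, hx.2⟩, ?_⟩
  · linarith [le_abs_self (q x), hQ x (Ioo_subset_Icc_self hx), le_abs_self Q]
  · rcases le_or_gt x (1 - ε₃) with hxr | hxr
    · rw [max_eq_right (by linarith)]; simpa
    · rw [max_eq_left (by linarith)]
      have := hxl ⟨hxr, hx.2⟩
      nlinarith [hx.2]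

end Damping

theorem absolutelyContinuous_ramp (r : ℝ) :
    AbsolutelyContinuousOnInterval (fun x => max (x - r) 0) 0 1 := by
  have : LipschitzWith 1 (fun x : ℝ => max (x - r) 0) := by
    have h1 : LipschitzWith 1 (fun x : ℝ => x - r) := by
      simpa [sub_eq_add_neg] using (LipschitzWith.id (α := ℝ)).add (LipschitzWith.const (-r))
    exact h1.max_const 0
  exact (this.lipschitzOnWith (s := uIcc 0 1)).absolutelyContinuousOnInterval

theorem ae_hasDerivAt_sq_ramp (r : ℝ) :
    ∀ᵐ x : ℝ, HasDerivAt (fun x => max (x - r) 0 ^ 2) (2 * max (x - r) 0) x := by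
  have : ∀ᵐ x : ℝ, x ≠ r := by simp [ae_iff]
  filter_upwards [this] with x hx
  rcases lt_or_gt_of_ne hx with h | h
  · rw [max_eq_right (by linarith)]
    refine ((hasDerivAt_const x (0:ℝ)).congr_of_eventuallyEq ?_).congr_deriv (by simp)
    filter_upwards [eventually_lt_nhds h] with y hy
    rw [max_eq_right (by linarith)]; simp
  · rw [max_eq_left (by linarith)]
    refine ((((hasDerivAt_id x).sub_const r).pow 2).congr_of_eventuallyEq ?_).congr_deriv (by simp)
    filter_upwards [eventually_gt_nhds h] with y hy
    rw [max_eq_left (by linarith)]; simp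

namespace SpatialSlice

variable {a q v p z y : ℝ → ℝ} {a_min a_max ε₃ q_min : ℝ}

theorem intervalIntegrable_damping_mul (hq : AssumptionA2' q ε₃ q_min) {f : ℝ → ℝ}
    (hf : ContinuousOn f (Icc 0 1)) : IntervalIntegrable (fun x => q x * f x) volume 0 1 :=
  hq.intervalIntegrable.mul_continuousOn (by simpa using hf)

theorem intervalIntegrable_damping_mul_sq (hq : AssumptionA2' q ε₃ q_min) {f : ℝ → ℝ}
    (hf : ContinuousOn f (Icc 0 1)) : IntervalIntegrable (fun x => q x * f x ^ 2) volume 0 1 :=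
  intervalIntegrable_damping_mul hq (hf.pow 2)

theorem ae_deriv_v (h : SpatialSlice a q v p z y) :
    ∀ᵐ x ∂(volume.restrict (Ioo (0:ℝ) 1)), HasDerivAt v (y x) x := by
  rw [ae_restrict_iff' measurableSet_Ioo]
  exact ae_of_all _ h.deriv_v

theorem integral_damping_nonneg (hq : AssumptionA2' q ε₃ q_min) (v : ℝ → ℝ) :
    0 ≤ ∫ x in (0:ℝ)..1, q x * v x ^ 2 := by
  rw [intervalIntegral.integral_of_le zero_le_one, ← restrict_Ioo_eq_restrict_Ioc]
  obtain ⟨-, -, h0, -⟩ := hq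
  refine integral_nonneg_of_ae ?_
  filter_upwards [h0] with x hx
  exact mul_nonneg hx (sq_nonneg _)

theorem integral_power_balance (h : SpatialSlice a q v p z y) (ha : AssumptionA1 a a_min a_max)
    (hq : AssumptionA2' q ε₃ q_min) :
    ∫ x in (0:ℝ)..1, (v x * z x + a x * p x * y x) =
      a 1 * p 1 * v 1 - a 0 * p 0 * v 0 - ∫ x in (0:ℝ)..1, q x * v x ^ 2 := by
  have hac := h.ac_flux.fun_mul h.ac_v
  obtain ⟨-, heq⟩ := hac.intervalIntegrable_and_integral_eq_sub_of_ae_hasDerivAt zero_le_one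
    (by filter_upwards [h.deriv_flux, h.ae_deriv_v] with x h1 h2 using h1.mul h2)
  have hi1 : IntervalIntegrable (fun x => v x * z x + a x * p x * y x) volume 0 1 :=
    ContinuousOn.intervalIntegrable_of_Icc zero_le_one
      ((h.cont_v.mul h.cont_z).add ((ha.continuousOn.mul h.cont_p).mul h.cont_y))
  have hi2 := intervalIntegrable_damping_mul_sq hq h.cont_v
  rw [← heq, ← intervalIntegral.integral_sub (by
    refine (hi1.add hi2).congr fun x _ => ?_
    ring) hi2]
  refine intervalIntegral.integral_congr fun x _ => ?_
  ring

theorem integral_acceleration (h : SpatialSlice a q v p z y) {x : ℝ} (hx : x ∈ Icc (0:ℝ) 1)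
    (hq : AssumptionA2' q ε₃ q_min) :
    ∫ s in x..1, z s = a 1 * p 1 - a x * p x - ∫ s in x..1, q s * v s := by
  have hsub : uIcc x 1 ⊆ uIcc 0 1 := by
    rw [uIcc_of_le hx.2, uIcc_of_le zero_le_one]; exact Icc_subset_Icc_left hx.1
  obtain ⟨hi, heq⟩ := (h.ac_flux.mono hsub).intervalIntegrable_and_integral_eq_sub_of_ae_hasDerivAt
    hx.2 (ae_restrict_of_ae_restrict_of_subset (Ioo_subset_Ioo_left hx.1) h.deriv_flux)
  have hi2 := (intervalIntegrable_damping_mul hq h.cont_v).mono_set hsub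
  rw [← heq, ← intervalIntegral.integral_sub hi hi2]
  simp

/-- Cauchy-Schwarz for the damping force. -/
theorem exists_sq_integral_damping_le (hq : AssumptionA2' q ε₃ q_min) :
    ∃ Q > 0, ∀ v : ℝ → ℝ, ContinuousOn v (Icc 0 1) → ∀ x ∈ Icc (0:ℝ) 1,
      (∫ s in x..1, q s * v s) ^ 2 ≤ Q * ∫ s in (0:ℝ)..1, q s * v s ^ 2 := by
  obtain ⟨Q, hQ, hae⟩ := hq.ae_bounds
  refine ⟨Q, hQ, fun v hv x hx => ?_⟩
  have hsub : uIcc x 1 ⊆ uIcc 0 1 := by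
    rw [uIcc_of_le hx.2, uIcc_of_le zero_le_one]; exact Icc_subset_Icc_left hx.1
  have hi2 := intervalIntegrable_damping_mul_sq hq hv
  have hi1 := intervalIntegrable_damping_mul hq hv
  have hi3 : IntervalIntegrable (fun s => (q s * v s) ^ 2) volume 0 1 := by
    refine (hi2.const_mul Q).mono_fun' (by
      rw [uIoc_of_le zero_le_one]; exact hi1.aestronglyMeasurable.pow 2) ?_
    rw [uIoc_of_le zero_le_one, ← restrict_Ioo_eq_restrict_Ioc]
    filter_upwards [hae] with s hs
    simp only [norm_pow, Real.norm_eq_abs, sq_abs]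
    nlinarith [mul_nonneg (mul_nonneg hs.1 (sub_nonneg.2 hs.2.1)) (sq_nonneg (v s))]
  calc (∫ s in x..1, q s * v s) ^ 2 ≤ ∫ s in x..1, (q s * v s) ^ 2 :=
        sq_intervalIntegral_le hx.2 (by linarith [hx.1]) (hi1.mono_set hsub) (hi3.mono_set hsub)
    _ ≤ ∫ s in (0:ℝ)..1, (q s * v s) ^ 2 :=
        intervalIntegral.integral_mono_interval hx.1 hx.2 le_rfl
          (ae_of_all _ fun s => sq_nonneg _) hi3
    _ ≤ ∫ s in (0:ℝ)..1, Q * (q s * v s ^ 2) := by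
        refine intervalIntegral_mono_of_ae_Ioo zero_le_one hi3 (hi2.const_mul Q) ?_
        filter_upwards [hae] with s hs
        nlinarith [mul_nonneg (mul_nonneg hs.1 (sub_nonneg.2 hs.2.1)) (sq_nonneg (v s))]
    _ = Q * ∫ s in (0:ℝ)..1, q s * v s ^ 2 := by rw [intervalIntegral.integral_const_mul]

/-- Control of the tail momentum by the damping, on the support of the ramp. -/
theorem ramp_mul_sq_tail_le (hq : AssumptionA2' q ε₃ q_min) (hv : ContinuousOn v (Icc 0 1))
    {x : ℝ} (hx : x ∈ Icc (0:ℝ) 1) :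
    q_min * (max (x - (1 - ε₃)) 0 * (∫ s in x..1, v s) ^ 2) ≤
      ∫ s in (0:ℝ)..1, q s * v s ^ 2 := by
  have hn := integral_damping_nonneg hq v
  obtain ⟨-, -, h0, he, he1, hqm, -⟩ := id hq
  obtain ⟨Q, hQ, hae⟩ := hq.ae_bounds
  rcases le_or_gt x (1 - ε₃) with hxr | hxr
  · rw [max_eq_right (by linarith)]; simpa
  have hsub : uIcc x 1 ⊆ uIcc 0 1 := by
    rw [uIcc_of_le hx.2, uIcc_of_le zero_le_one]; exact Icc_subset_Icc_left hx.1
  have hi1 : IntervalIntegrable v volume 0 1 := hv.intervalIntegrable_of_Icc zero_le_one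
  have hi2 : IntervalIntegrable (fun s => v s ^ 2) volume 0 1 :=
    (hv.pow 2).intervalIntegrable_of_Icc zero_le_one
  have hi3 := intervalIntegrable_damping_mul_sq hq hv
  have h1 := sq_intervalIntegral_le hx.2 (by linarith [hx.1]) (hi1.mono_set hsub)
    (hi2.mono_set hsub)
  have h2 : q_min * ∫ s in x..1, v s ^ 2 ≤ ∫ s in x..1, q s * v s ^ 2 := by
    rw [← intervalIntegral.integral_const_mul]
    refine intervalIntegral_mono_of_ae_Ioo hx.2 ((hi2.mono_set hsub).const_mul _)
      (hi3.mono_set hsub) ?_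
    have h4 := ae_restrict_of_ae_restrict_of_subset (Ioo_subset_Ioo_left hx.1) hae
    rw [ae_restrict_iff' measurableSet_Ioo] at h4 ⊢
    filter_upwards [h4] with s hs hsI
    exact mul_le_mul_of_nonneg_right ((hs hsI).2.2.1 (hxr.trans hsI.1)) (sq_nonneg _)
  have h3 : ∫ s in x..1, q s * v s ^ 2 ≤ ∫ s in (0:ℝ)..1, q s * v s ^ 2 := by
    refine intervalIntegral.integral_mono_interval hx.1 hx.2 le_rfl ?_ hi3
    rw [← restrict_Ioo_eq_restrict_Ioc]
    filter_upwards [h0] with s hs using mul_nonneg hs (sq_nonneg _)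
  have h5 : max (x - (1 - ε₃)) 0 * (∫ s in x..1, v s) ^ 2 ≤ 1 * (∫ s in x..1, v s) ^ 2 :=
    mul_le_mul_of_nonneg_right (max_le (by linarith [hx.2]) zero_le_one) (sq_nonneg _)
  calc _ ≤ q_min * ∫ s in x..1, v s ^ 2 := mul_le_mul_of_nonneg_left (by linarith) hqm.le
    _ ≤ _ := h2.trans h3

end SpatialSlice

section Multiplier

/-- The weight `(1 - x) e^{kx}` of the flux multiplier. -/
noncomputable def multiplierWeight (k x : ℝ) : ℝ := (1 - x) * Real.exp (k * x)

theorem hasDerivAt_multiplierWeight (k x : ℝ) :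
    HasDerivAt (multiplierWeight k) (Real.exp (k * x) * (k * (1 - x) - 1)) x := by
  have h1 : HasDerivAt (fun x : ℝ => 1 - x) (-1) x := by
    simpa using (hasDerivAt_id x).const_sub 1
  have h2 : HasDerivAt (fun x : ℝ => Real.exp (k * x)) (Real.exp (k * x) * k) x := by
    simpa using ((hasDerivAt_id x).const_mul k).exp
  exact (h1.mul h2).congr_deriv (by ring)

theorem continuous_multiplierWeight (k : ℝ) : Continuous (multiplierWeight k) := by
  unfold multiplierWeight; fun_prop

theorem absolutelyContinuous_multiplierWeight (k : ℝ) :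
    AbsolutelyContinuousOnInterval (multiplierWeight k) 0 1 := by
  have : ContDiff ℝ 1 (multiplierWeight k) := by unfold multiplierWeight; fun_prop
  exact this.contDiffOn.absolutelyContinuousOnInterval

theorem multiplierWeight_nonneg {k x : ℝ} (hx : x ∈ Icc (0:ℝ) 1) : 0 ≤ multiplierWeight k x :=
  mul_nonneg (by linarith [hx.2]) (Real.exp_pos _).le

theorem multiplierWeight_le {k x : ℝ} (hk : 0 ≤ k) (hx : x ∈ Icc (0:ℝ) 1) :
    multiplierWeight k x ≤ Real.exp k := by
  have h1 : Real.exp (k * x) ≤ Real.exp k := Real.exp_le_exp.2 (by nlinarith [hx.2])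
  have h2 : (1 - x) * Real.exp (k * x) ≤ 1 * Real.exp (k * x) :=
    mul_le_mul_of_nonneg_right (by linarith [hx.1]) (Real.exp_pos _).le
  unfold multiplierWeight; linarith

/-- Away from `x = 1` the weight grows; the defect near `x = 1` is controlled by the ramp. -/
theorem half_sub_le_exp_mul {k ε x : ℝ} (hk : 0 ≤ k) (hkε : 4 ≤ k * ε) (hx : x ∈ Icc (0:ℝ) 1) :
    1 / 2 - (Real.exp k * k) ^ 2 / 8 * max (x - (1 - ε)) 0 ^ 2 ≤
      Real.exp (k * x) * (k / 2 * (1 - x) - 1) := by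
  set s := max (x - (1 - ε)) 0 with hs
  have hs0 : 0 ≤ s := le_max_right _ _
  have hsx : x - (1 - ε) ≤ s := le_max_left _ _
  have hX1 : 1 ≤ Real.exp (k * x) := Real.one_le_exp (mul_nonneg hk hx.1)
  have hXB : Real.exp (k * x) ≤ Real.exp k := Real.exp_le_exp.2 (by nlinarith [hx.2])
  have h1 : 1 - k / 2 * s ≤ k / 2 * (1 - x) - 1 := by nlinarith
  have h2 : Real.exp (k * x) * (1 - k / 2 * s) ≤ Real.exp (k * x) * (k / 2 * (1 - x) - 1) :=
    mul_le_mul_of_nonneg_left h1 (by linarith)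
  have h3 : Real.exp (k * x) * (k / 2 * s) ≤ Real.exp k * (k / 2 * s) :=
    mul_le_mul_of_nonneg_right hXB (by positivity)
  nlinarith [sq_nonneg (1 - Real.exp k * (k / 2 * s))]

theorem multiplier_integrand_le {a_min a_max Q q_min B M A A' G G' p v q φ : ℝ}
    (ha : 0 < a_min) (hq : 0 < q_min) (hM : 0 ≤ M)
    (hA : a_min ≤ A) (hA2 : A ≤ a_max) (hφ : 0 ≤ φ)
    (hG' : 1 / 2 - M * φ ≤ G') (hG'A : A * (1 / 2 - M * φ) ≤ G' * A + G * A')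
    (hG : 0 ≤ G) (hGB : G ≤ B) (hq0 : 0 ≤ q) (hqQ : q ≤ Q) (hφq : q_min * φ ≤ q) :
    -(1 / 2) * G' * ((A * p) ^ 2 + A * v ^ 2) - 1 / 2 * G * A' * v ^ 2 - G * A * p * q * v ≤
      -(min (a_min ^ 2 / 8) (a_min / 4)) * (v ^ 2 + p ^ 2) + M * a_max ^ 2 / 2 * (φ * p ^ 2)
        + (M * a_max / (2 * q_min) + 2 * B ^ 2 * a_max ^ 2 * Q / a_min ^ 2) * (q * v ^ 2) := by
  have hA0 : 0 < A := by linarith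
  have hamax : 0 ≤ a_max := by linarith
  have hB : 0 ≤ B := hG.trans hGB
  have hQ : 0 ≤ Q := hq0.trans hqQ
  have hAsq : a_min ^ 2 ≤ A ^ 2 := by gcongr
  have hAsq2 : A ^ 2 ≤ a_max ^ 2 := by gcongr
  have hp : -(1 / 2) * G' * (A * p) ^ 2 ≤ -(a_min ^ 2 / 4) * p ^ 2 + M * a_max ^ 2 / 2 * (φ * p ^ 2) := by
    have h1 := mul_le_mul_of_nonneg_right hG' (sq_nonneg (A * p))
    have h2 := mul_le_mul_of_nonneg_right hAsq (sq_nonneg p)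
    have h3 := mul_le_mul_of_nonneg_right hAsq2 (mul_nonneg hM (mul_nonneg hφ (sq_nonneg p)))
    nlinarith
  have hv : -(1 / 2) * (G' * A + G * A') * v ^ 2 ≤
      -(a_min / 4) * v ^ 2 + M * a_max / (2 * q_min) * (q * v ^ 2) := by
    have h1 := mul_le_mul_of_nonneg_right hG'A (sq_nonneg v)
    have h2 := mul_le_mul_of_nonneg_right hA (sq_nonneg v)
    have h3 : A * (M * φ) * v ^ 2 ≤ M * a_max / q_min * (q * v ^ 2) := by
      have h4 : φ ≤ q / q_min := by rw [le_div_iff₀ hq]; linarith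
      calc A * (M * φ) * v ^ 2 ≤ a_max * (M * (q / q_min)) * v ^ 2 := by gcongr
        _ = _ := by ring
    have h5 : M * a_max / (2 * q_min) * (q * v ^ 2) = 1 / 2 * (M * a_max / q_min * (q * v ^ 2)) := by
      ring
    nlinarith
  have hc : -(G * A * p * q * v) ≤
      a_min ^ 2 / 8 * p ^ 2 + 2 * B ^ 2 * a_max ^ 2 * Q / a_min ^ 2 * (q * v ^ 2) := by
    have h1 : -(G * A * p * q * v) ≤
        a_min ^ 2 / 8 * p ^ 2 + 2 * (G * A) ^ 2 / a_min ^ 2 * (q ^ 2 * v ^ 2) := by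
      have h0 : a_min ^ 2 / 8 * p ^ 2 + 2 * (G * A) ^ 2 / a_min ^ 2 * (q ^ 2 * v ^ 2)
          + G * A * p * q * v = 1 / 8 * (a_min * p + 4 * (G * A) / a_min * (q * v)) ^ 2 := by
        field_simp
        ring
      nlinarith [sq_nonneg (a_min * p + 4 * (G * A) / a_min * (q * v))]
    have h2 : 2 * (G * A) ^ 2 / a_min ^ 2 * (q ^ 2 * v ^ 2) ≤
        2 * (B * a_max) ^ 2 / a_min ^ 2 * (Q * q * v ^ 2) := by
      have : q ^ 2 ≤ Q * q := by nlinarith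
      gcongr
    calc _ ≤ _ := h1
      _ ≤ a_min ^ 2 / 8 * p ^ 2 + 2 * (B * a_max) ^ 2 / a_min ^ 2 * (Q * q * v ^ 2) := by linarith
      _ = _ := by ring
  have h1 := mul_le_mul_of_nonneg_right (min_le_left (a_min ^ 2 / 8) (a_min / 4)) (sq_nonneg p)
  have h2 := mul_le_mul_of_nonneg_right (min_le_right (a_min ^ 2 / 8) (a_min / 4)) (sq_nonneg v)
  nlinarith

end Multiplier

namespace SpatialSlice

variable {a q v p z y : ℝ → ℝ} {a_min a_max ε₃ q_min : ℝ}

set_option maxHeartbeats 1000000 in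
/-- The flux multiplier estimate: up to the damping and the strain near `x = 1`, it controls the
bulk energy. -/
theorem exists_flux_multiplier_le (ha : AssumptionA1 a a_min a_max)
    (hq : AssumptionA2' q ε₃ q_min) :
    ∃ k > 0, ∃ c > 0, ∃ M > 0, ∃ C > 0, ∀ v p z y : ℝ → ℝ, SpatialSlice a q v p z y →
      ∫ x in (0:ℝ)..1, a x * multiplierWeight k x * (z x * p x + v x * y x) ≤
        -c * ((∫ x in (0:ℝ)..1, v x ^ 2) + ∫ x in (0:ℝ)..1, p x ^ 2)
          + M * (∫ x in (0:ℝ)..1, max (x - (1 - ε₃)) 0 ^ 2 * p x ^ 2)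
          + C * ∫ x in (0:ℝ)..1, q x * v x ^ 2 := by
  obtain ⟨Q, hQ, hqae⟩ := hq.ae_bounds
  obtain ⟨K, hK, hKae⟩ := ha.ae_hasDerivAt
  obtain ⟨-, hamin, hamm, hab⟩ := id ha
  obtain ⟨-, -, -, he, he1, hqm, -⟩ := id hq
  set k := 2 * K / a_min + 4 / ε₃ with hk
  have hk0 : 0 < k := by positivity
  have hkε : 4 ≤ k * ε₃ := by
    have : k * ε₃ = 2 * K / a_min * ε₃ + 4 := by rw [hk]; field_simp
    have : 0 ≤ 2 * K / a_min * ε₃ := by positivity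
    linarith
  have hkK : 2 * K ≤ k * a_min := by
    have : k * a_min = 2 * K + 4 / ε₃ * a_min := by rw [hk]; field_simp
    have : 0 ≤ 4 / ε₃ * a_min := by positivity
    linarith
  set B := Real.exp k with hB
  have hBpos : 0 < B := Real.exp_pos _
  have hamax : 0 < a_max := by linarith
  set M := (B * k) ^ 2 / 8 with hM
  have hM0 : 0 < M := by positivity
  set c := min (a_min ^ 2 / 8) (a_min / 4) with hc
  set C := M * a_max / (2 * q_min) + 2 * B ^ 2 * a_max ^ 2 * Q / a_min ^ 2 with hC
  refine ⟨k, hk0, c, by positivity, M * a_max ^ 2 / 2, by positivity, C, by positivity, ?_⟩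
  intro v p z y h
  set g := multiplierWeight k with hg
  have hac : AbsolutelyContinuousOnInterval
      (fun x => 1 / 2 * (g x * (a x * p x * (a x * p x) + a x * (v x * v x)))) 0 1 :=
    ((absolutelyContinuous_multiplierWeight k).fun_mul ((h.ac_flux.fun_mul h.ac_flux).fun_add
      (ha.absolutelyContinuous.fun_mul (h.ac_v.fun_mul h.ac_v)))).const_mul (1 / 2)
  obtain ⟨hi, heq⟩ := hac.intervalIntegrable_and_integral_eq_sub_of_ae_hasDerivAt zero_le_one
    (by
      filter_upwards [h.deriv_flux, h.ae_deriv_v, hKae] with x h1 h2 h3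
      exact ((hasDerivAt_multiplierWeight k x).mul
        ((h1.mul h1).add (h3.1.mul (h2.mul h2)))).const_mul (1 / 2))
  have hca := ha.continuousOn
  have hcg : ContinuousOn g (Icc 0 1) := (continuous_multiplierWeight k).continuousOn
  have hiv : IntervalIntegrable (fun x => v x ^ 2) volume 0 1 :=
    (h.cont_v.pow 2).intervalIntegrable_of_Icc zero_le_one
  have hip : IntervalIntegrable (fun x => p x ^ 2) volume 0 1 :=
    (h.cont_p.pow 2).intervalIntegrable_of_Icc zero_le_one
  have hiφ : IntervalIntegrable (fun x => max (x - (1 - ε₃)) 0 ^ 2 * p x ^ 2) volume 0 1 :=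
    ContinuousOn.intervalIntegrable_of_Icc zero_le_one
      (ContinuousOn.mul (Continuous.continuousOn (by fun_prop)) (h.cont_p.pow 2))
  have hiq := intervalIntegrable_damping_mul_sq hq h.cont_v
  have hir : IntervalIntegrable (fun x => -c * (v x ^ 2 + p x ^ 2)
      + M * a_max ^ 2 / 2 * (max (x - (1 - ε₃)) 0 ^ 2 * p x ^ 2) + C * (q x * v x ^ 2))
      volume 0 1 :=
    (((hiv.add hip).const_mul _).add (hiφ.const_mul _)).add (hiq.const_mul _)
  have hiJ : IntervalIntegrable (fun x => a x * g x * (z x * p x + v x * y x)) volume 0 1 :=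
    ContinuousOn.intervalIntegrable_of_Icc zero_le_one ((hca.mul hcg).mul
      ((h.cont_z.mul h.cont_p).add (h.cont_v.mul h.cont_y)))
  have hmono := intervalIntegral_mono_of_ae_Ioo zero_le_one hiJ (hi.add hir) (by
    have hI : ∀ᵐ x ∂(volume.restrict (Ioo (0:ℝ) 1)), x ∈ Ioo (0:ℝ) 1 :=
      ae_restrict_mem measurableSet_Ioo
    filter_upwards [hqae, hKae, hI] with x hqx hax hx
    have hx' := Ioo_subset_Icc_self hx
    have hs1 : max (x - (1 - ε₃)) 0 ≤ 1 := max_le (by linarith [hx.2]) zero_le_one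
    have hs0 : 0 ≤ max (x - (1 - ε₃)) 0 := le_max_right _ _
    have hw := half_sub_le_exp_mul hk0.le hkε hx'
    have hE := Real.exp_pos (k * x)
    have hw' : 1 / 2 - M * max (x - (1 - ε₃)) 0 ^ 2 ≤ Real.exp (k * x) * (k * (1 - x) - 1) := by
      refine hw.trans (mul_le_mul_of_nonneg_left ?_ hE.le)
      nlinarith [hx.2]
    have hwA : a x * (1 / 2 - M * max (x - (1 - ε₃)) 0 ^ 2) ≤
        Real.exp (k * x) * (k * (1 - x) - 1) * a x + g x * deriv a x := by
      have hax0 := (hab x hx').1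
      have h1 : a x * (1 / 2 - M * max (x - (1 - ε₃)) 0 ^ 2) ≤
          a x * (Real.exp (k * x) * (k / 2 * (1 - x) - 1)) :=
        mul_le_mul_of_nonneg_left hw (by linarith)
      have h2 : -K ≤ deriv a x := (abs_le.1 hax.2).1
      have h3 : 0 ≤ k / 2 * a x + deriv a x := by nlinarith
      have h4 : 0 ≤ Real.exp (k * x) * (1 - x) * (k / 2 * a x + deriv a x) :=
        mul_nonneg (mul_nonneg hE.le (by linarith [hx.2])) h3
      simp only [hg, multiplierWeight]
      nlinarith
    have key := multiplier_integrand_le (p := p x) (v := v x) hamin hqm hM0.le (hab x hx').1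
      (hab x hx').2 (sq_nonneg (max (x - (1 - ε₃)) 0)) hw' hwA (multiplierWeight_nonneg hx')
      (multiplierWeight_le hk0.le hx') hqx.1 hqx.2.1 (by nlinarith [hqx.2.2.2])
    rw [← hB, ← hc, ← hC] at key
    refine le_trans (le_of_eq ?_) (add_le_add_right key _)
    simp only [← hg, Pi.add_apply, Pi.mul_apply]
    ring)
  refine hmono.trans ?_
  rw [intervalIntegral.integral_add hi hir, heq,
    intervalIntegral.integral_add (((hiv.add hip).const_mul _).add (hiφ.const_mul _))
      (hiq.const_mul _),
    intervalIntegral.integral_add ((hiv.add hip).const_mul _) (hiφ.const_mul _),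
    intervalIntegral.integral_const_mul, intervalIntegral.integral_const_mul,
    intervalIntegral.integral_const_mul, intervalIntegral.integral_add hiv hip]
  have hg1 : g 1 = 0 := by simp [hg, multiplierWeight]
  have hg0 : g 0 = 1 := by simp [hg, multiplierWeight]
  have ha0 := (hab 0 (by simp)).1
  rw [hg1, hg0]
  have : 0 ≤ a 0 * p 0 * (a 0 * p 0) + a 0 * (v 0 * v 0) := by
    have := mul_self_nonneg (a 0 * p 0)
    have := mul_nonneg (hamin.le.trans ha0) (mul_self_nonneg (v 0))
    linarith
  linarith

end SpatialSlice

section Tail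

theorem absolutelyContinuous_tail {f : ℝ → ℝ} (hf : IntervalIntegrable f volume 0 1) :
    AbsolutelyContinuousOnInterval (fun x => ∫ s in x..1, f s) 0 1 := by
  have h : (fun x => ∫ s in x..1, f s) = fun x => -∫ s in (1:ℝ)..x, f s :=
    funext fun x => intervalIntegral.integral_symm _ _
  rw [h]
  exact (hf.absolutelyContinuousOnInterval_intervalIntegral (c := 1) (by simp)).fun_neg

theorem hasDerivAt_tail {f : ℝ → ℝ} (hf : ContinuousOn f (Icc 0 1)) {x : ℝ}
    (hx : x ∈ Ioo (0:ℝ) 1) : HasDerivAt (fun x => ∫ s in x..1, f s) (-f x) x := by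
  have hf' := hf.mono Ioo_subset_Icc_self
  refine intervalIntegral.integral_hasDerivAt_left ?_
    (hf'.stronglyMeasurableAtFilter isOpen_Ioo x hx) (hf'.continuousAt (Ioo_mem_nhds hx.1 hx.2))
  exact (hf.mono (Icc_subset_Icc_left hx.1.le)).intervalIntegrable_of_Icc hx.2.le

theorem tail_integrand_le {a_min A s P R k e p v q QV q_min Q : ℝ} (ha : 0 < a_min)
    (hq : 0 < q_min) (hA : a_min ≤ A) (hs : 0 ≤ s) (hs1 : s ≤ 1) (hsq : q_min * s ≤ q)
    (hR : R ^ 2 ≤ Q * QV) (hP : q_min * (s * P ^ 2) ≤ QV) :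
    s ^ 2 * ((-(A * p) - R - e) * p) - 2 * s * (P + k) * v + s ^ 2 * v ^ 2 ≤
      -(a_min / 2) * (s ^ 2 * p ^ 2) + ((Q / a_min + 2 / q_min) * QV + e ^ 2 / a_min + 2 * k ^ 2)
        + 2 / q_min * (q * v ^ 2) := by
  have hss : s ^ 2 ≤ s := by nlinarith
  have hss1 : s ^ 2 ≤ 1 := by linarith
  have h1 : s ^ 2 * ((-(A * p) - R - e) * p) ≤
      -(a_min / 2) * (s ^ 2 * p ^ 2) + (Q / a_min * QV + e ^ 2 / a_min) := by
    have h2 : (-(A * p) - R - e) * p ≤ -(a_min / 2) * p ^ 2 + (R ^ 2 + e ^ 2) / a_min := by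
      have h3 : (-(a_min * p) - R - e) * p ≤ -(a_min / 2) * p ^ 2 + (R ^ 2 + e ^ 2) / a_min := by
        have h4 : -(a_min / 2) * p ^ 2 + (R ^ 2 + e ^ 2) / a_min - (-(a_min * p) - R - e) * p =
            ((a_min * p + (R + e)) ^ 2 + (R - e) ^ 2) / (2 * a_min) := by
          field_simp
          ring
        have : 0 ≤ ((a_min * p + (R + e)) ^ 2 + (R - e) ^ 2) / (2 * a_min) := by positivity
        linarith
      nlinarith [mul_le_mul_of_nonneg_right hA (sq_nonneg p)]
    have h5 := mul_le_mul_of_nonneg_left h2 (sq_nonneg s)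
    have h6 : s ^ 2 * ((R ^ 2 + e ^ 2) / a_min) ≤ 1 * ((R ^ 2 + e ^ 2) / a_min) :=
      mul_le_mul_of_nonneg_right hss1 (by positivity)
    have h7 : (R ^ 2 + e ^ 2) / a_min ≤ (Q * QV + e ^ 2) / a_min := by gcongr
    have h8 : (Q * QV + e ^ 2) / a_min = Q / a_min * QV + e ^ 2 / a_min := by ring
    nlinarith
  have hsv : s * v ^ 2 ≤ 1 / q_min * (q * v ^ 2) := by
    have h4 : s ≤ q / q_min := by rw [le_div_iff₀ hq]; linarith
    calc s * v ^ 2 ≤ q / q_min * v ^ 2 := by gcongr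
      _ = _ := by ring
  have hsP : s * P ^ 2 ≤ 1 / q_min * QV := by
    rw [one_div, inv_mul_eq_div, le_div_iff₀ hq]; linarith
  have h9 : -(2 * s * (P + k) * v) ≤ 2 * (s * P ^ 2) + 2 * k ^ 2 + s * v ^ 2 := by
    have h10 : s * k ^ 2 ≤ 1 * k ^ 2 := mul_le_mul_of_nonneg_right hs1 (sq_nonneg k)
    nlinarith [mul_nonneg hs (sq_nonneg (P + k + v)), mul_nonneg hs (sq_nonneg (P - k))]
  have h11 : s ^ 2 * v ^ 2 ≤ s * v ^ 2 := mul_le_mul_of_nonneg_right hss (sq_nonneg v)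
  have h12 : (Q / a_min + 2 / q_min) * QV = Q / a_min * QV + 2 * (1 / q_min * QV) := by ring
  have h13 : 2 / q_min * (q * v ^ 2) = 2 * (1 / q_min * (q * v ^ 2)) := by ring
  linarith

end Tail

namespace SpatialSlice

variable {a q v p z y : ℝ → ℝ} {a_min a_max ε₃ q_min : ℝ}

set_option maxHeartbeats 1000000 in
/-- The tail multiplier estimate: it controls the strain near `x = 1`. -/
theorem exists_tail_multiplier_le (ha : AssumptionA1 a a_min a_max)
    (hq : AssumptionA2' q ε₃ q_min) :
    ∃ c > 0, ∃ C > 0, ∀ v p z y : ℝ → ℝ, SpatialSlice a q v p z y → ∀ k e : ℝ,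
      ∫ x in (0:ℝ)..1, max (x - (1 - ε₃)) 0 ^ 2 *
          ((-(a x * p x) - (∫ s in x..1, q s * v s) - e) * p x + ((∫ s in x..1, v s) + k) * y x) ≤
        -c * (∫ x in (0:ℝ)..1, max (x - (1 - ε₃)) 0 ^ 2 * p x ^ 2)
          + C * ((∫ x in (0:ℝ)..1, q x * v x ^ 2) + e ^ 2 + k ^ 2 + v 1 ^ 2) := by
  obtain ⟨_, -, hqae⟩ := hq.ae_bounds
  obtain ⟨Q, hQ, hR⟩ := exists_sq_integral_damping_le hq
  obtain ⟨-, hamin, -, hab⟩ := id ha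
  obtain ⟨-, -, -, he, he1, hqm, -⟩ := id hq
  refine ⟨a_min / 2, by positivity, Q / a_min + 4 / q_min + 1 / a_min + 3, by positivity, ?_⟩
  intro v p z y h k e
  have hV := integral_damping_nonneg hq v
  set QV := ∫ x in (0:ℝ)..1, q x * v x ^ 2 with hQV
  have hca := ha.continuousOn
  have hi1 : IntervalIntegrable v volume 0 1 := h.cont_v.intervalIntegrable_of_Icc zero_le_one
  have hacP := absolutelyContinuous_tail hi1
  have hcP : ContinuousOn (fun x => ∫ s in x..1, v s) (Icc 0 1) := by simpa using hacP.continuousOn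
  have hcR : ContinuousOn (fun x => ∫ s in x..1, q s * v s) (Icc 0 1) := by
    simpa using (absolutelyContinuous_tail (intervalIntegrable_damping_mul hq h.cont_v)).continuousOn
  have hcφ : ContinuousOn (fun x => max (x - (1 - ε₃)) 0 ^ 2) (Icc 0 1) :=
    Continuous.continuousOn (by fun_prop)
  have hack : AbsolutelyContinuousOnInterval (fun _ : ℝ => k) 0 1 :=
    (LipschitzWith.const k).lipschitzOnWith.absolutelyContinuousOnInterval
  have hacφ : AbsolutelyContinuousOnInterval (fun x => max (x - (1 - ε₃)) 0 ^ 2) 0 1 := by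
    simpa only [sq] using (absolutelyContinuous_ramp (1 - ε₃)).fun_mul
      (absolutelyContinuous_ramp (1 - ε₃))
  have hac := hacφ.fun_mul ((hacP.fun_add hack).fun_mul h.ac_v)
  obtain ⟨hi, heq⟩ := hac.intervalIntegrable_and_integral_eq_sub_of_ae_hasDerivAt zero_le_one
    (f' := fun x => 2 * max (x - (1 - ε₃)) 0 * (((∫ s in x..1, v s) + k) * v x)
      + max (x - (1 - ε₃)) 0 ^ 2 * (-v x * v x + ((∫ s in x..1, v s) + k) * y x)) (by
      have hI : ∀ᵐ x ∂(volume.restrict (Ioo (0:ℝ) 1)), x ∈ Ioo (0:ℝ) 1 :=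
        ae_restrict_mem measurableSet_Ioo
      filter_upwards [ae_restrict_of_ae (ae_hasDerivAt_sq_ramp (1 - ε₃)), hI] with x h1 hx
      exact h1.mul (((hasDerivAt_tail h.cont_v hx).add_const k).mul (h.deriv_v x hx)))
  have hiφ : IntervalIntegrable (fun x => max (x - (1 - ε₃)) 0 ^ 2 * p x ^ 2) volume 0 1 :=
    (hcφ.mul (h.cont_p.pow 2)).intervalIntegrable_of_Icc zero_le_one
  have hiq := intervalIntegrable_damping_mul_sq hq h.cont_v
  have hiJ : IntervalIntegrable (fun x => max (x - (1 - ε₃)) 0 ^ 2 *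
      ((-(a x * p x) - (∫ s in x..1, q s * v s) - e) * p x + ((∫ s in x..1, v s) + k) * y x))
      volume 0 1 :=
    (hcφ.mul (((((hca.mul h.cont_p).neg.sub hcR).sub continuousOn_const).mul h.cont_p).add
      ((hcP.add continuousOn_const).mul h.cont_y))).intervalIntegrable_of_Icc zero_le_one
  set b := (Q / a_min + 2 / q_min) * QV + e ^ 2 / a_min + 2 * k ^ 2 with hb
  have hib : IntervalIntegrable (fun _ : ℝ => b) volume 0 1 := intervalIntegrable_const
  have hir : IntervalIntegrable (fun x => -(a_min / 2) * (max (x - (1 - ε₃)) 0 ^ 2 * p x ^ 2) + b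
      + 2 / q_min * (q x * v x ^ 2)) volume 0 1 :=
    ((hiφ.const_mul _).add hib).add (hiq.const_mul _)
  have hmono := intervalIntegral_mono_of_ae_Ioo zero_le_one hiJ (hi.add hir) (by
    have hI : ∀ᵐ x ∂(volume.restrict (Ioo (0:ℝ) 1)), x ∈ Ioo (0:ℝ) 1 :=
      ae_restrict_mem measurableSet_Ioo
    filter_upwards [hqae, hI] with x hqx hx
    have hx' := Ioo_subset_Icc_self hx
    have key := tail_integrand_le (k := k) (e := e) (p := p x) (v := v x) hamin hqm (hab x hx').1
      (le_max_right (x - (1 - ε₃)) 0) (max_le (by linarith [hx.2]) zero_le_one) hqx.2.2.2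
      (hR v h.cont_v x hx') (ramp_mul_sq_tail_le hq h.cont_v hx')
    refine le_trans (le_of_eq ?_) (add_le_add_right key _)
    ring)
  refine hmono.trans ?_
  rw [intervalIntegral.integral_add hi hir, heq,
    intervalIntegral.integral_add ((hiφ.const_mul _).add hib) (hiq.const_mul _),
    intervalIntegral.integral_add (hiφ.const_mul _) hib,
    intervalIntegral.integral_const_mul, intervalIntegral.integral_const_mul, ← hQV,
    intervalIntegral.integral_const, max_eq_right (by linarith : (0:ℝ) - (1 - ε₃) ≤ 0),
    max_eq_left (by linarith : (0:ℝ) ≤ 1 - (1 - ε₃)), intervalIntegral.integral_same, hb]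
  have h1 : (1 - (1 - ε₃)) ^ 2 * ((0 + k) * v 1) ≤ k ^ 2 + v 1 ^ 2 := by
    have h2 : k * v 1 ≤ k ^ 2 + v 1 ^ 2 := by nlinarith [sq_nonneg (k - v 1), sq_nonneg (k + v 1)]
    have h3 : ε₃ ^ 2 ≤ 1 := by nlinarith
    have h4 : ε₃ ^ 2 * (k * v 1) ≤ ε₃ ^ 2 * (k ^ 2 + v 1 ^ 2) :=
      mul_le_mul_of_nonneg_left h2 (sq_nonneg _)
    nlinarith [sq_nonneg k, sq_nonneg (v 1)]
  have h5 : (Q / a_min + 4 / q_min + 1 / a_min + 3) * (QV + e ^ 2 + k ^ 2 + v 1 ^ 2) =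
      (Q / a_min + 2 / q_min) * QV + e ^ 2 / a_min + 2 * k ^ 2 + 2 / q_min * QV + (k ^ 2 + v 1 ^ 2)
      + ((1 / a_min + 3) * QV + (Q / a_min + 4 / q_min + 3) * e ^ 2
        + (Q / a_min + 4 / q_min + 1 / a_min) * k ^ 2
        + (Q / a_min + 4 / q_min + 1 / a_min + 2) * v 1 ^ 2) := by ring
  have h6 : 0 ≤ (1 / a_min + 3) * QV + (Q / a_min + 4 / q_min + 3) * e ^ 2
        + (Q / a_min + 4 / q_min + 1 / a_min) * k ^ 2
        + (Q / a_min + 4 / q_min + 1 / a_min + 2) * v 1 ^ 2 := by positivity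
  simp only [smul_eq_mul]
  linarith

end SpatialSlice

section Parametric

variable {F F' : ℝ → ℝ → ℝ}

theorem continuousOn_slice (hF : ContinuousOn ↿F (Ici (0:ℝ) ×ˢ Icc (0:ℝ) 1)) {t : ℝ}
    (ht : 0 ≤ t) : ContinuousOn (F t) (Icc 0 1) :=
  hF.comp (f := fun x => (t, x)) (by fun_prop) fun _ hx => ⟨ht, hx⟩

theorem continuousOn_tail_integral (hF : ContinuousOn ↿F (Ici (0:ℝ) ×ˢ Icc (0:ℝ) 1)) :
    ContinuousOn ↿(fun t x => ∫ y in x..1, F t y) (Ici (0:ℝ) ×ˢ Icc (0:ℝ) 1) := by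
  have hG : Continuous (Function.uncurry
      fun (r : ℝ × ℝ) y => F (max r.1 0) (max 0 (min y 1))) := by
    rw [← continuousOn_univ]
    exact hF.comp (f := fun r : (ℝ × ℝ) × ℝ => (max r.1.1 0, max 0 (min r.2 1)))
      (Continuous.continuousOn (by fun_prop))
      fun r _ => ⟨mem_Ici.2 (le_max_right _ _), le_max_left _ _, max_le zero_le_one (min_le_right _ _)⟩
  have h := (intervalIntegral.continuous_parametric_intervalIntegral_of_continuous
    (μ := volume) (a₀ := 1) hG continuous_snd).neg
  refine h.continuousOn.congr ?_
  rintro ⟨t, x⟩ ⟨ht, hx⟩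
  simp only [Function.HasUncurry.uncurry, id]
  rw [intervalIntegral.integral_symm]
  refine congrArg _ (intervalIntegral.integral_congr fun y hy => ?_)
  rw [uIcc_of_ge hx.2] at hy
  simp only
  rw [max_eq_left ht, min_eq_left hy.2, max_eq_right (hx.1.trans hy.1)]

theorem continuousOn_integral (hF : ContinuousOn ↿F (Ici (0:ℝ) ×ˢ Icc (0:ℝ) 1)) :
    ContinuousOn (fun t => ∫ x in (0:ℝ)..1, F t x) (Ici 0) :=
  (continuousOn_tail_integral hF).comp (f := fun t => (t, 0)) (by fun_prop)
    fun _ ht => ⟨ht, left_mem_Icc.2 zero_le_one⟩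

theorem hasDerivAt_tail_integral (hF : ContinuousOn ↿F (Ici (0:ℝ) ×ˢ Icc (0:ℝ) 1))
    (hF' : ContinuousOn ↿F' (Ici (0:ℝ) ×ˢ Icc (0:ℝ) 1))
    (h : ∀ t > 0, ∀ x ∈ Ioo (0:ℝ) 1, HasDerivAt (fun s => F s x) (F' t x) t) {t x : ℝ}
    (ht : 0 < t) (hx : x ∈ Icc (0:ℝ) 1) :
    HasDerivAt (fun s => ∫ y in x..1, F s y) (∫ y in x..1, F' t y) t := by
  have hsub : Icc x 1 ⊆ Icc 0 1 := Icc_subset_Icc_left hx.1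
  have hint : ∀ {G : ℝ → ℝ → ℝ}, ContinuousOn ↿G (Ici (0:ℝ) ×ˢ Icc (0:ℝ) 1) → ∀ s > 0,
      IntervalIntegrable (G s) volume x 1 := fun hG s hs =>
    ((continuousOn_slice hG hs.le).mono hsub).intervalIntegrable_of_Icc hx.2
  obtain ⟨B, hB⟩ := ((isCompact_Icc (a := t / 2) (b := 2 * t)).prod
    (isCompact_Icc (a := (0:ℝ)) (b := 1))).exists_bound_of_continuousOn
    (hF'.mono (prod_mono_left fun s hs => (half_pos ht).le.trans hs.1))
  have hne : ∀ᵐ y : ℝ, y ≠ 1 := by simp [ae_iff, measure_singleton]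
  refine (intervalIntegral.hasDerivAt_integral_of_dominated_loc_of_deriv_le (bound := fun _ => B)
    (Icc_mem_nhds (half_lt_self ht) (by linarith : t < 2 * t)) ?_ (hint hF t ht)
    (hint hF' t ht).aestronglyMeasurable_restrict_uIoc ?_ intervalIntegrable_const ?_).2
  · filter_upwards [lt_mem_nhds ht] with s hs using (hint hF s hs).aestronglyMeasurable_restrict_uIoc
  · refine ae_of_all _ fun y hy s hs => hB (s, y) ⟨hs, ?_⟩
    rw [uIoc_of_le hx.2] at hy
    exact ⟨hx.1.trans hy.1.le, hy.2⟩
  · filter_upwards [hne] with y hy1 hy s hs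
    rw [uIoc_of_le hx.2] at hy
    exact h s ((half_pos ht).trans_le hs.1) y ⟨hx.1.trans_lt hy.1, lt_of_le_of_ne hy.2 hy1⟩

theorem hasDerivAt_integral (hF : ContinuousOn ↿F (Ici (0:ℝ) ×ˢ Icc (0:ℝ) 1))
    (hF' : ContinuousOn ↿F' (Ici (0:ℝ) ×ˢ Icc (0:ℝ) 1))
    (h : ∀ t > 0, ∀ x ∈ Ioo (0:ℝ) 1, HasDerivAt (fun s => F s x) (F' t x) t) {t : ℝ}
    (ht : 0 < t) :
    HasDerivAt (fun s => ∫ x in (0:ℝ)..1, F s x) (∫ x in (0:ℝ)..1, F' t x) t :=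
  hasDerivAt_tail_integral hF hF' h ht (left_mem_Icc.2 zero_le_one)

end Parametric

namespace ClassicalSolutionS

variable {a q : ℝ → ℝ} {α₁ α₂ β₁ γ₁ μ₁ : ℝ}

/-- The mixed derivative `u_tx`, as the spatial derivative of `u_t`. -/
noncomputable def utx (sol : ClassicalSolutionS a q α₁ α₂ β₁ γ₁ μ₁) (t x : ℝ) : ℝ :=
  fderivWithin ℝ (fun p : ℝ × ℝ => sol.ut p.1 p.2) (Ici (0:ℝ) ×ˢ Icc (0:ℝ) 1) (t, x) (0, 1)

theorem strip_mem_nhds {t x : ℝ} (ht : 0 < t) (hx : x ∈ Ioo (0:ℝ) 1) :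
    Ici (0:ℝ) ×ˢ Icc (0:ℝ) 1 ∈ 𝓝 (t, x) :=
  prod_mem_nhds (Ici_mem_nhds ht) (Icc_mem_nhds hx.1 hx.2)

theorem uniqueDiffOn_strip : UniqueDiffOn ℝ (Ici (0:ℝ) ×ˢ Icc (0:ℝ) 1) :=
  (uniqueDiffOn_Ici 0).prod (uniqueDiffOn_Icc zero_lt_one)

variable (sol : ClassicalSolutionS a q α₁ α₂ β₁ γ₁ μ₁)

theorem continuousOn_ut : ContinuousOn ↿sol.ut (Ici (0:ℝ) ×ˢ Icc (0:ℝ) 1) :=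
  sol.hut_C1.continuousOn

theorem continuousOn_ux : ContinuousOn ↿sol.ux (Ici (0:ℝ) ×ˢ Icc (0:ℝ) 1) :=
  sol.hux_C1.continuousOn

theorem continuousOn_utx : ContinuousOn ↿sol.utx (Ici (0:ℝ) ×ˢ Icc (0:ℝ) 1) :=
  (sol.hut_C1.continuousOn_fderivWithin uniqueDiffOn_strip le_rfl).clm_apply continuousOn_const

theorem continuousOn_utt : ContinuousOn ↿sol.utt (Ici (0:ℝ) ×ˢ Icc (0:ℝ) 1) := by
  refine ((sol.hut_C1.continuousOn_fderivWithin uniqueDiffOn_strip le_rfl).clm_apply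
    (continuousOn_const (c := ((1:ℝ), (0:ℝ))))).congr ?_
  rintro ⟨t, x⟩ ⟨ht, hx⟩
  have hd := (sol.hut_C1.differentiableOn one_ne_zero (t, x) ⟨ht, hx⟩).hasFDerivWithinAt
  have hc := hd.comp_hasDerivWithinAt (f := fun s => (s, x)) t (s := Ici 0)
    ((hasDerivAt_id t).prodMk (hasDerivAt_const t x)).hasDerivWithinAt fun s hs => ⟨hs, hx⟩
  exact (uniqueDiffOn_Ici 0 t ht).eq_deriv _ (sol.hu_tt t ht x hx).hasDerivWithinAt hc

theorem hasFDerivAt_ut {t x : ℝ} (ht : 0 < t) (hx : x ∈ Ioo (0:ℝ) 1) :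
    HasFDerivAt (fun p : ℝ × ℝ => sol.ut p.1 p.2)
      (fderivWithin ℝ (fun p : ℝ × ℝ => sol.ut p.1 p.2) (Ici (0:ℝ) ×ˢ Icc (0:ℝ) 1) (t, x))
      (t, x) :=
  (sol.hut_C1.differentiableOn one_ne_zero (t, x)
    (mem_of_mem_nhds (strip_mem_nhds ht hx))).hasFDerivWithinAt.hasFDerivAt (strip_mem_nhds ht hx)

theorem hasDerivAt_ut {t x : ℝ} (ht : 0 < t) (hx : x ∈ Ioo (0:ℝ) 1) :
    HasDerivAt (sol.ut t) (sol.utx t x) x :=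
  (sol.hasFDerivAt_ut ht hx).comp_hasDerivAt (f := fun y => (t, y)) x
    ((hasDerivAt_const x t).prodMk (hasDerivAt_id x))

/-- Symmetry of the mixed second derivatives of the displacement. -/
theorem hasDerivAt_ux {t x : ℝ} (ht : 0 < t) (hx : x ∈ Ioo (0:ℝ) 1) :
    HasDerivAt (fun s => sol.ux s x) (sol.utx t x) t := by
  have hX := (sol.hux_C1.differentiableOn one_ne_zero (t, x)
    (mem_of_mem_nhds (strip_mem_nhds ht hx))).hasFDerivWithinAt.hasFDerivAt (strip_mem_nhds ht hx)
  have hev : ∀ᶠ r : ℝ × ℝ in 𝓝 (t, x), r ∈ Ioi (0:ℝ) ×ˢ Ioo (0:ℝ) 1 :=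
    prod_mem_nhds (Ioi_mem_nhds ht) (Ioo_mem_nhds hx.1 hx.2)
  have hu : ∀ᶠ r : ℝ × ℝ in 𝓝 (t, x), HasFDerivAt ↿sol.u
      (sol.ut r.1 r.2 • ContinuousLinearMap.fst ℝ ℝ ℝ
        + sol.ux r.1 r.2 • ContinuousLinearMap.snd ℝ ℝ ℝ) r := by
    filter_upwards [hev] with r hr
    have hr' : Ioi (0:ℝ) ×ˢ Ioo (0:ℝ) 1 ∈ 𝓝 r :=
      prod_mem_nhds (Ioi_mem_nhds hr.1) (Ioo_mem_nhds hr.2.1 hr.2.2)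
    have hs := strip_mem_nhds hr.1 hr.2
    have h := (hasStrictFDerivAt_uncurry_coprod (f := sol.u)
      (f₁ := fun s y => (ContinuousLinearMap.id ℝ ℝ).smulRight (sol.ut s y))
      (f₂ := fun s y => (ContinuousLinearMap.id ℝ ℝ).smulRight (sol.ux s y)) (u := r) ?_ ?_ ?_
      ?_).hasFDerivAt
    · refine h.congr_fderiv ?_
      ext <;> simp [Function.HasUncurry.uncurry]
    · filter_upwards [hr'] with w hw
      exact (sol.hu_t w.1 (mem_Ici.2 (le_of_lt hw.1)) w.2 (Ioo_subset_Icc_self hw.2)).hasFDerivAt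
    · filter_upwards [hr'] with w hw
      exact (sol.hu_x w.1 (mem_Ici.2 (le_of_lt hw.1)) w.2 (Ioo_subset_Icc_self hw.2)).hasFDerivAt
    · exact (ContinuousLinearMap.smulRightL ℝ ℝ ℝ (ContinuousLinearMap.id ℝ ℝ)).continuous.continuousAt.comp
        (sol.continuousOn_ut.continuousAt hs)
    · exact (ContinuousLinearMap.smulRightL ℝ ℝ ℝ (ContinuousLinearMap.id ℝ ℝ)).continuous.continuousAt.comp
        (sol.continuousOn_ux.continuousAt hs)
  have hsymm := second_derivative_symmetric_of_eventually hu
    (((sol.hasFDerivAt_ut ht hx).smul_const (ContinuousLinearMap.fst ℝ ℝ ℝ)).add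
      (hX.smul_const (ContinuousLinearMap.snd ℝ ℝ ℝ))) (1, 0) (0, 1)
  have hd := hX.comp_hasDerivAt (f := fun s => (s, x)) t
    ((hasDerivAt_id t).prodMk (hasDerivAt_const t x))
  refine hd.congr_deriv ?_
  simpa [utx] using hsymm

theorem spatialSlice {t : ℝ} (ht : 0 < t) :
    SpatialSlice a q (sol.ut t) (sol.ux t) (sol.utt t) (sol.utx t) where
  cont_v := continuousOn_slice sol.continuousOn_ut ht.le
  cont_p := continuousOn_slice sol.continuousOn_ux ht.le
  cont_z := continuousOn_slice sol.continuousOn_utt ht.le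
  cont_y := continuousOn_slice sol.continuousOn_utx ht.le
  deriv_v := fun _ hx => sol.hasDerivAt_ut ht hx
  ac_v := by
    refine ContDiffOn.absolutelyContinuousOnInterval ?_
    rw [uIcc_of_le zero_le_one]
    exact sol.hut_C1.comp (f := fun x => (t, x)) (by fun_prop) fun x hx => ⟨ht.le, hx⟩
  ac_flux := by
    obtain ⟨K, hK⟩ := sol.haux_lip t ht.le
    rw [← uIcc_of_le zero_le_one] at hK
    exact hK.absolutelyContinuousOnInterval
  deriv_flux := by
    filter_upwards [sol.haux t ht.le, sol.hPDE t ht.le] with x h1 h2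
    convert h1 using 1
    linarith

end ClassicalSolutionS

theorem abs_intervalIntegral_le_of_abs_le {f g : ℝ → ℝ} (hg : ContinuousOn g (Icc 0 1))
    (h : ∀ x ∈ Icc (0:ℝ) 1, |f x| ≤ g x) :
    |∫ x in (0:ℝ)..1, f x| ≤ ∫ x in (0:ℝ)..1, g x :=
  intervalIntegral.norm_integral_le_of_norm_le (f := f) (μ := volume) zero_le_one
    (ae_of_all _ fun x hx => h x (Ioc_subset_Icc_self hx))
    (hg.intervalIntegrable_of_Icc zero_le_one)

/-- A nonnegative functional whose derivative is at most `-κ E` bounds the integral of `κ E`. -/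
theorem mul_integral_le_of_hasDerivAt_le {L L' E : ℝ → ℝ} {κ S T : ℝ}
    (hL : ContinuousOn L (Ici 0)) (hE : ContinuousOn E (Ici 0))
    (hd : ∀ t > 0, HasDerivAt L (L' t) t) (hle : ∀ t > 0, L' t ≤ -(κ * E t)) (hS : 0 ≤ S)
    (hST : S ≤ T) (hT : 0 ≤ L T) : κ * (∫ t in S..T, E t) ≤ L S := by
  have hsub : Icc S T ⊆ Ici 0 := fun t ht => hS.trans ht.1
  have h := intervalIntegral.integral_le_sub_of_hasDeriv_right_of_le hST (hL.mono hsub).neg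
    (fun t ht => (hd t (hS.trans_lt ht.1)).neg.hasDerivWithinAt)
    ((hE.mono hsub).const_smul κ |>.integrableOn_Icc)
    (fun t ht => by
      have := hle t (hS.trans_lt ht.1)
      simp only [Pi.smul_apply, smul_eq_mul]
      linarith)
  simp only [smul_eq_mul, Pi.neg_apply, Pi.smul_apply] at h
  rw [intervalIntegral.integral_const_mul] at h
  linarith

namespace ClassicalSolutionS

variable {a q : ℝ → ℝ} {a_min a_max ε₃ q_min α₁ α₂ β₁ γ₁ μ₁ : ℝ}

/-- The squared norm of the state, equivalent to the energy. -/
noncomputable def stateNormSq (sol : ClassicalSolutionS a q α₁ α₂ β₁ γ₁ μ₁) (t : ℝ) : ℝ :=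
  (∫ x in (0:ℝ)..1, sol.ut t x ^ 2) + (∫ x in (0:ℝ)..1, sol.ux t x ^ 2)
    + sol.η₁ t ^ 2 + sol.η₂ t ^ 2 + sol.ζ₁ t ^ 2

/-- The quantity controlled by the decay of the energy. -/
noncomputable def dissipation (sol : ClassicalSolutionS a q α₁ α₂ β₁ γ₁ μ₁) (t : ℝ) : ℝ :=
  (∫ x in (0:ℝ)..1, q x * sol.ut t x ^ 2) + sol.η₁ t ^ 2 + sol.ζ₁ t ^ 2

/-- The functional associated with the flux multiplier. -/
noncomputable def fluxFunctional (sol : ClassicalSolutionS a q α₁ α₂ β₁ γ₁ μ₁) (k t : ℝ) : ℝ :=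
  ∫ x in (0:ℝ)..1, a x * multiplierWeight k x * (sol.ut t x * sol.ux t x)

/-- The functional associated with the tail multiplier. -/
noncomputable def tailFunctional (sol : ClassicalSolutionS a q α₁ α₂ β₁ γ₁ μ₁) (ε₃ t : ℝ) : ℝ :=
  ∫ x in (0:ℝ)..1, max (x - (1 - ε₃)) 0 ^ 2 *
    (((∫ s in x..1, sol.ut t s) + a 1 / β₁ * sol.η₁ t) * sol.ux t x)

/-- The total momentum, including the boundary masses. -/
noncomputable def momentum (sol : ClassicalSolutionS a q α₁ α₂ β₁ γ₁ μ₁) (t : ℝ) : ℝ :=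
  (∫ x in (0:ℝ)..1, sol.ut t x) + a 1 / β₁ * sol.η₁ t + a 0 / μ₁ * sol.ζ₁ t

theorem continuousOn_coeff {f : ℝ → ℝ} (hf : ContinuousOn f (Icc 0 1)) :
    ContinuousOn ↿(fun (_ : ℝ) x => f x) (Ici (0:ℝ) ×ˢ Icc (0:ℝ) 1) :=
  hf.comp continuousOn_snd fun _ hr => hr.2

theorem continuousOn_time {f : ℝ → ℝ} (hf : ContinuousOn f (Ici 0)) :
    ContinuousOn ↿(fun t (_ : ℝ) => f t) (Ici (0:ℝ) ×ˢ Icc (0:ℝ) 1) :=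
  hf.comp continuousOn_fst fun _ hr => hr.1

variable (sol : ClassicalSolutionS a q α₁ α₂ β₁ γ₁ μ₁)

theorem continuousOn_energyS (ha : AssumptionA1 a a_min a_max) :
    ContinuousOn (energyS sol) (Ici 0) := by
  have h : ContinuousOn (fun t => ∫ x in (0:ℝ)..1, (sol.ut t x ^ 2 + a x * sol.ux t x ^ 2)) (Ici 0) :=
    continuousOn_integral (F := fun t x => sol.ut t x ^ 2 + a x * sol.ux t x ^ 2)
      ((sol.continuousOn_ut.pow 2).add
        ((continuousOn_coeff ha.continuousOn).mul (sol.continuousOn_ux.pow 2)))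
  exact (((h.const_mul _).add ((sol.hη₁C1.continuousOn.pow 2).const_mul _)).add
    ((sol.hη₂C1.continuousOn.pow 2).const_mul _)).add ((sol.hζ₁C1.continuousOn.pow 2).const_mul _)

theorem continuousOn_fluxFunctional (ha : AssumptionA1 a a_min a_max) (k : ℝ) :
    ContinuousOn (sol.fluxFunctional k) (Ici 0) :=
  continuousOn_integral (F := fun t x => a x * multiplierWeight k x * (sol.ut t x * sol.ux t x))
    ((continuousOn_coeff
      (ha.continuousOn.mul (continuous_multiplierWeight k).continuousOn)).mul
      (sol.continuousOn_ut.mul sol.continuousOn_ux))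

theorem continuousOn_tailFunctional (ε₃ : ℝ) : ContinuousOn (sol.tailFunctional ε₃) (Ici 0) :=
  continuousOn_integral (F := fun t x => max (x - (1 - ε₃)) 0 ^ 2 *
    (((∫ s in x..1, sol.ut t s) + a 1 / β₁ * sol.η₁ t) * sol.ux t x))
    (((continuousOn_coeff (f := fun x => max (x - (1 - ε₃)) 0 ^ 2)
        (Continuous.continuousOn (by fun_prop))).mul
      (((continuousOn_tail_integral sol.continuousOn_ut).add
        (continuousOn_time (sol.hη₁C1.continuousOn.const_mul (a 1 / β₁)))).mul
          sol.continuousOn_ux)).congr fun _ _ => rfl)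

theorem continuousOn_momentum : ContinuousOn sol.momentum (Ici 0) :=
  ((continuousOn_integral sol.continuousOn_ut).add (sol.hη₁C1.continuousOn.const_mul _)).add
    (sol.hζ₁C1.continuousOn.const_mul _)

theorem hasDerivAt_energyS (ha : AssumptionA1 a a_min a_max) (hq : AssumptionA2' q ε₃ q_min)
    (hβ₁ : β₁ ≠ 0) (hμ₁ : μ₁ ≠ 0) {t : ℝ} (ht : 0 < t) :
    HasDerivAt (energyS sol) (-(∫ x in (0:ℝ)..1, q x * sol.ut t x ^ 2)
      - a 1 * α₁ / β₁ * sol.η₁ t ^ 2 - a 0 * γ₁ / μ₁ * sol.ζ₁ t ^ 2) t := by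
  have hs := sol.spatialSlice ht
  have h : HasDerivAt (fun t => ∫ x in (0:ℝ)..1, (sol.ut t x ^ 2 + a x * sol.ux t x ^ 2))
      (∫ x in (0:ℝ)..1, 2 * (sol.ut t x * sol.utt t x + a x * sol.ux t x * sol.utx t x)) t := by
    refine hasDerivAt_integral (F := fun t x => sol.ut t x ^ 2 + a x * sol.ux t x ^ 2)
      (F' := fun t x => 2 * (sol.ut t x * sol.utt t x + a x * sol.ux t x * sol.utx t x))
      (((sol.continuousOn_ut.pow 2).add
        ((continuousOn_coeff ha.continuousOn).mul (sol.continuousOn_ux.pow 2))).congr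
          fun _ _ => rfl)
      ((((sol.continuousOn_ut.mul sol.continuousOn_utt).add
        (((continuousOn_coeff ha.continuousOn).mul sol.continuousOn_ux).mul
          sol.continuousOn_utx)).const_mul 2).congr fun _ _ => rfl) (fun s hs x hx => ?_) ht
    refine (((sol.hu_tt s hs.le x (Ioo_subset_Icc_self hx)).pow 2).add
      (((sol.hasDerivAt_ux hs hx).pow 2).const_mul (a x))).congr_deriv ?_
    simp only [Nat.cast_ofNat]
    ring
  rw [intervalIntegral.integral_const_mul, hs.integral_power_balance ha hq, sol.hbc1 t ht.le,
    sol.hbc0 t ht.le] at h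
  refine ((((h.const_mul _).add (((sol.hode1 t ht.le).pow 2).const_mul _)).add
    (((sol.hode2 t ht.le).pow 2).const_mul _)).add
    (((sol.hode3 t ht.le).pow 2).const_mul _)).congr_deriv ?_
  simp only [Nat.cast_ofNat]
  field_simp
  ring

theorem hasDerivAt_fluxFunctional (ha : AssumptionA1 a a_min a_max) (k : ℝ) {t : ℝ}
    (ht : 0 < t) :
    HasDerivAt (sol.fluxFunctional k) (∫ x in (0:ℝ)..1, a x * multiplierWeight k x *
      (sol.utt t x * sol.ux t x + sol.ut t x * sol.utx t x)) t := by
  have hc := continuousOn_coeff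
      (ha.continuousOn.mul (continuous_multiplierWeight k).continuousOn)
  exact hasDerivAt_integral
    (F := fun t x => a x * multiplierWeight k x * (sol.ut t x * sol.ux t x))
    (F' := fun t x => a x * multiplierWeight k x *
      (sol.utt t x * sol.ux t x + sol.ut t x * sol.utx t x))
    (hc.mul (sol.continuousOn_ut.mul sol.continuousOn_ux))
    (hc.mul ((sol.continuousOn_utt.mul sol.continuousOn_ux).add
      (sol.continuousOn_ut.mul sol.continuousOn_utx)))
    (fun s hs x hx => ((sol.hu_tt s hs.le x (Ioo_subset_Icc_self hx)).mul
      (sol.hasDerivAt_ux hs hx)).const_mul _) ht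

theorem hasDerivAt_tailFunctional (hq : AssumptionA2' q ε₃ q_min) (hβ₁ : β₁ ≠ 0) {t : ℝ}
    (ht : 0 < t) :
    HasDerivAt (sol.tailFunctional ε₃) (∫ x in (0:ℝ)..1, max (x - (1 - ε₃)) 0 ^ 2 *
      ((-(a x * sol.ux t x) - (∫ s in x..1, q s * sol.ut t s)
          - a 1 / β₁ * (α₁ * sol.η₁ t + α₂ * sol.η₂ t)) * sol.ux t x
        + ((∫ s in x..1, sol.ut t s) + a 1 / β₁ * sol.η₁ t) * sol.utx t x)) t := by
  have hc := continuousOn_coeff (f := fun x => max (x - (1 - ε₃)) 0 ^ 2)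
    (Continuous.continuousOn (by fun_prop))
  have hP := (continuousOn_tail_integral sol.continuousOn_ut).add
    (continuousOn_time (sol.hη₁C1.continuousOn.const_mul (a 1 / β₁)))
  have hux1 : ContinuousOn (fun t => sol.ux t 1) (Ici 0) :=
    sol.continuousOn_ux.comp (f := fun t => (t, (1:ℝ))) (by fun_prop)
      fun t ht => ⟨ht, right_mem_Icc.2 zero_le_one⟩
  have hP' := (continuousOn_tail_integral sol.continuousOn_utt).add
    (continuousOn_time ((((sol.hη₁C1.continuousOn.const_mul (-α₁)).sub
      (sol.hη₂C1.continuousOn.const_mul α₂)).sub (hux1.const_mul β₁)).const_mul (a 1 / β₁)))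
  refine (hasDerivAt_integral (F := fun t x => max (x - (1 - ε₃)) 0 ^ 2 *
      (((∫ s in x..1, sol.ut t s) + a 1 / β₁ * sol.η₁ t) * sol.ux t x))
    (F' := fun t x => max (x - (1 - ε₃)) 0 ^ 2 *
      (((∫ s in x..1, sol.utt t s)
          + a 1 / β₁ * (-α₁ * sol.η₁ t - α₂ * sol.η₂ t - β₁ * sol.ux t 1)) * sol.ux t x
        + ((∫ s in x..1, sol.ut t s) + a 1 / β₁ * sol.η₁ t) * sol.utx t x))
    ((hc.mul (hP.mul sol.continuousOn_ux)).congr fun _ _ => rfl)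
    ((hc.mul ((hP'.mul sol.continuousOn_ux).add (hP.mul sol.continuousOn_utx))).congr
      fun _ _ => rfl)
    (fun s hs x hx => ?_) ht).congr_deriv ?_
  · exact (((hasDerivAt_tail_integral sol.continuousOn_ut sol.continuousOn_utt
      (fun r hr y hy => sol.hu_tt r hr.le y (Ioo_subset_Icc_self hy)) hs
      (Ioo_subset_Icc_self hx)).add ((sol.hode1 s hs.le).const_mul _)).mul
      (sol.hasDerivAt_ux hs hx)).const_mul _
  · refine intervalIntegral.integral_congr fun x hx => ?_
    rw [uIcc_of_le zero_le_one] at hx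
    rw [(sol.spatialSlice ht).integral_acceleration hx hq]
    field_simp
    ring

theorem hasDerivAt_momentum (hq : AssumptionA2' q ε₃ q_min) (hβ₁ : β₁ ≠ 0) (hμ₁ : μ₁ ≠ 0)
    {t : ℝ} (ht : 0 < t) :
    HasDerivAt sol.momentum (-(∫ x in (0:ℝ)..1, q x * sol.ut t x)
      - a 1 / β₁ * (α₁ * sol.η₁ t + α₂ * sol.η₂ t) - a 0 / μ₁ * (γ₁ * sol.ζ₁ t)) t := by
  refine (((hasDerivAt_integral sol.continuousOn_ut sol.continuousOn_utt
      (fun r hr y hy => sol.hu_tt r hr.le y (Ioo_subset_Icc_self hy)) ht).add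
      ((sol.hode1 t ht.le).const_mul _)).add ((sol.hode3 t ht.le).const_mul _)).congr_deriv ?_
  rw [(sol.spatialSlice ht).integral_acceleration (left_mem_Icc.2 zero_le_one) hq]
  field_simp
  ring

end ClassicalSolutionS

namespace ClassicalSolutionS

variable {a q : ℝ → ℝ} {a_min a_max ε₃ q_min α₁ α₂ β₁ γ₁ μ₁ : ℝ}

section Comparison

theorem continuousOn_sq_ut (sol : ClassicalSolutionS a q α₁ α₂ β₁ γ₁ μ₁) {t : ℝ} (ht : 0 ≤ t) :
    ContinuousOn (fun x => sol.ut t x ^ 2) (Icc 0 1) :=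
  (continuousOn_slice sol.continuousOn_ut ht).pow 2

theorem continuousOn_sq_ux (sol : ClassicalSolutionS a q α₁ α₂ β₁ γ₁ μ₁) {t : ℝ} (ht : 0 ≤ t) :
    ContinuousOn (fun x => sol.ux t x ^ 2) (Icc 0 1) :=
  (continuousOn_slice sol.continuousOn_ux ht).pow 2

theorem integral_sq_ut_nonneg (sol : ClassicalSolutionS a q α₁ α₂ β₁ γ₁ μ₁) (t : ℝ) :
    0 ≤ ∫ x in (0:ℝ)..1, sol.ut t x ^ 2 :=
  intervalIntegral.integral_nonneg zero_le_one fun _ _ => sq_nonneg _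

theorem integral_sq_ux_nonneg (sol : ClassicalSolutionS a q α₁ α₂ β₁ γ₁ μ₁) (t : ℝ) :
    0 ≤ ∫ x in (0:ℝ)..1, sol.ux t x ^ 2 :=
  intervalIntegral.integral_nonneg zero_le_one fun _ _ => sq_nonneg _

theorem stateNormSq_nonneg (sol : ClassicalSolutionS a q α₁ α₂ β₁ γ₁ μ₁) (t : ℝ) :
    0 ≤ sol.stateNormSq t := by
  have h1 := sol.integral_sq_ut_nonneg t
  have h2 := sol.integral_sq_ux_nonneg t
  unfold stateNormSq
  positivity

/-- The energy is equivalent to the squared norm of the state. -/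
theorem exists_stateNormSq_le_energyS_le (ha : AssumptionA1 a a_min a_max) (hα₂ : 0 < α₂)
    (hβ₁ : 0 < β₁) (hμ₁ : 0 < μ₁) :
    ∃ k > 0, ∃ K > 0, ∀ sol : ClassicalSolutionS a q α₁ α₂ β₁ γ₁ μ₁, ∀ t ≥ 0,
      k * sol.stateNormSq t ≤ energyS sol t ∧ energyS sol t ≤ K * sol.stateNormSq t := by
  obtain ⟨-, hamin, hamm, hab⟩ := id ha
  have ha0 := hamin.trans_le (hab 0 (left_mem_Icc.2 zero_le_one)).1
  have ha1 := hamin.trans_le (hab 1 (right_mem_Icc.2 zero_le_one)).1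
  have hb1 : 0 < a 1 / (2 * β₁) := by positivity
  have hb2 : 0 < a 1 * α₂ / (2 * β₁) := by positivity
  have hb3 : 0 < a 0 / (2 * μ₁) := by positivity
  set b1 := a 1 / (2 * β₁)
  set b2 := a 1 * α₂ / (2 * β₁)
  set b3 := a 0 / (2 * μ₁)
  obtain ⟨k, hk, hk1⟩ : ∃ k > 0, k ≤ 1 / 2 ∧ k ≤ a_min / 2 ∧ k ≤ b1 ∧ k ≤ b2 ∧ k ≤ b3 := by
    refine ⟨min (1 / 2) (min (a_min / 2) (min b1 (min b2 b3))), by positivity, ?_⟩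
    have := le_refl (min (1 / 2) (min (a_min / 2) (min b1 (min b2 b3))))
    simpa only [le_min_iff] using this
  obtain ⟨h1, h2, h3, h4, h5⟩ := hk1
  have hamax := hamin.trans_le hamm
  refine ⟨k, hk, 1 / 2 + a_max / 2 + b1 + b2 + b3, by positivity, fun sol t ht => ?_⟩
  have hiV := (sol.continuousOn_sq_ut ht).intervalIntegrable_of_Icc (μ := volume) zero_le_one
  have hiU := (sol.continuousOn_sq_ux ht).intervalIntegrable_of_Icc (μ := volume) zero_le_one
  have hiA : IntervalIntegrable (fun x => a x * sol.ux t x ^ 2) volume 0 1 :=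
    (ha.continuousOn.mul (sol.continuousOn_sq_ux ht)).intervalIntegrable_of_Icc zero_le_one
  have hlo : a_min * (∫ x in (0:ℝ)..1, sol.ux t x ^ 2) ≤ ∫ x in (0:ℝ)..1, a x * sol.ux t x ^ 2 := by
    rw [← intervalIntegral.integral_const_mul]
    exact intervalIntegral.integral_mono_on zero_le_one (hiU.const_mul _) hiA
      fun x hx => mul_le_mul_of_nonneg_right (hab x hx).1 (sq_nonneg _)
  have hhi : (∫ x in (0:ℝ)..1, a x * sol.ux t x ^ 2) ≤ a_max * ∫ x in (0:ℝ)..1, sol.ux t x ^ 2 := by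
    rw [← intervalIntegral.integral_const_mul]
    exact intervalIntegral.integral_mono_on zero_le_one hiA (hiU.const_mul _)
      fun x hx => mul_le_mul_of_nonneg_right (hab x hx).2 (sq_nonneg _)
  have hV := sol.integral_sq_ut_nonneg t
  have hU := sol.integral_sq_ux_nonneg t
  rw [energyS, stateNormSq, intervalIntegral.integral_add hiV hiA]
  generalize (∫ x in (0:ℝ)..1, sol.ut t x ^ 2) = V at *
  generalize (∫ x in (0:ℝ)..1, sol.ux t x ^ 2) = U at *
  have hx := sq_nonneg (sol.η₁ t)
  have hy := sq_nonneg (sol.η₂ t)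
  have hz := sq_nonneg (sol.ζ₁ t)
  generalize sol.η₁ t ^ 2 = x at *
  generalize sol.η₂ t ^ 2 = y at *
  generalize sol.ζ₁ t ^ 2 = z at *
  constructor
  · linarith [mul_le_mul_of_nonneg_right h1 hV, mul_le_mul_of_nonneg_right h2 hU,
      mul_le_mul_of_nonneg_right h3 hx, mul_le_mul_of_nonneg_right h4 hy,
      mul_le_mul_of_nonneg_right h5 hz]
  · have e1 : 1 / 2 * V ≤ (1 / 2 + a_max / 2 + b1 + b2 + b3) * V :=
      mul_le_mul_of_nonneg_right (by linarith) hV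
    have e2 : a_max / 2 * U ≤ (1 / 2 + a_max / 2 + b1 + b2 + b3) * U :=
      mul_le_mul_of_nonneg_right (by linarith) hU
    have e3 : b1 * x ≤ (1 / 2 + a_max / 2 + b1 + b2 + b3) * x :=
      mul_le_mul_of_nonneg_right (by linarith) hx
    have e4 : b2 * y ≤ (1 / 2 + a_max / 2 + b1 + b2 + b3) * y :=
      mul_le_mul_of_nonneg_right (by linarith) hy
    have e5 : b3 * z ≤ (1 / 2 + a_max / 2 + b1 + b2 + b3) * z :=
      mul_le_mul_of_nonneg_right (by linarith) hz
    linarith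

theorem exists_abs_fluxFunctional_le (ha : AssumptionA1 a a_min a_max) {k : ℝ} (hk : 0 ≤ k) :
    ∃ K > 0, ∀ sol : ClassicalSolutionS a q α₁ α₂ β₁ γ₁ μ₁, ∀ t ≥ 0,
      |sol.fluxFunctional k t| ≤ K * sol.stateNormSq t := by
  obtain ⟨-, hamin, hamm, hab⟩ := id ha
  have hamax := hamin.trans_le hamm
  refine ⟨a_max * Real.exp k, by positivity, fun sol t ht => ?_⟩
  have hV := sol.continuousOn_sq_ut ht
  have hU := sol.continuousOn_sq_ux ht
  have h := abs_intervalIntegral_le_of_abs_le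
    (f := fun x => a x * multiplierWeight k x * (sol.ut t x * sol.ux t x))
    (g := fun x => a_max * Real.exp k * (sol.ut t x ^ 2 + sol.ux t x ^ 2))
    (continuousOn_const.mul (hV.add hU)) fun x hx => by
      have hax := hab x hx
      have hg := multiplierWeight_nonneg (k := k) hx
      rw [abs_mul, abs_of_nonneg (mul_nonneg (hamin.le.trans hax.1) hg)]
      refine mul_le_mul (mul_le_mul hax.2 (multiplierWeight_le hk hx) hg hamax.le) ?_
        (abs_nonneg _) (by positivity)
      rw [abs_le]
      constructor <;> nlinarith [sq_nonneg (sol.ut t x + sol.ux t x),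
        sq_nonneg (sol.ut t x - sol.ux t x)]
  rw [intervalIntegral.integral_const_mul, intervalIntegral.integral_add
    (hV.intervalIntegrable_of_Icc zero_le_one) (hU.intervalIntegrable_of_Icc zero_le_one)] at h
  refine h.trans (mul_le_mul_of_nonneg_left ?_ (by positivity))
  unfold stateNormSq
  linarith [sq_nonneg (sol.η₁ t), sq_nonneg (sol.η₂ t), sq_nonneg (sol.ζ₁ t)]

theorem sq_integral_ut_le (sol : ClassicalSolutionS a q α₁ α₂ β₁ γ₁ μ₁) {t x : ℝ} (ht : 0 ≤ t)
    (hx : x ∈ Icc (0:ℝ) 1) :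
    (∫ s in x..1, sol.ut t s) ^ 2 ≤ ∫ s in (0:ℝ)..1, sol.ut t s ^ 2 := by
  have hsub : Icc x 1 ⊆ Icc 0 1 := Icc_subset_Icc_left hx.1
  have hi := (sol.continuousOn_sq_ut ht).intervalIntegrable_of_Icc (μ := volume) zero_le_one
  refine (sq_intervalIntegral_le hx.2 (by linarith [hx.1])
    (((continuousOn_slice sol.continuousOn_ut ht).mono hsub).intervalIntegrable_of_Icc hx.2)
    (((sol.continuousOn_sq_ut ht).mono hsub).intervalIntegrable_of_Icc hx.2)).trans ?_
  exact intervalIntegral.integral_mono_interval hx.1 hx.2 le_rfl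
    (ae_of_all _ fun _ => sq_nonneg _) hi

theorem exists_abs_tailFunctional_le (hε : 0 < ε₃) (hε1 : ε₃ < 1) :
    ∃ K > 0, ∀ sol : ClassicalSolutionS a q α₁ α₂ β₁ γ₁ μ₁, ∀ t ≥ 0,
      |sol.tailFunctional ε₃ t| ≤ K * sol.stateNormSq t := by
  refine ⟨1 + (a 1 / β₁) ^ 2, by positivity, fun sol t ht => ?_⟩
  have hU := sol.continuousOn_sq_ux ht
  have h := abs_intervalIntegral_le_of_abs_le
    (f := fun x => max (x - (1 - ε₃)) 0 ^ 2 *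
      (((∫ s in x..1, sol.ut t s) + a 1 / β₁ * sol.η₁ t) * sol.ux t x))
    (g := fun x => ((∫ s in (0:ℝ)..1, sol.ut t s ^ 2) + (a 1 / β₁ * sol.η₁ t) ^ 2)
      + sol.ux t x ^ 2)
    (continuousOn_const.add hU) fun x hx => by
      have hP := sol.sq_integral_ut_le ht hx
      have h0 := le_max_right (x - (1 - ε₃)) 0
      have h1 : max (x - (1 - ε₃)) 0 ≤ 1 := max_le (by linarith [hx.2]) zero_le_one
      generalize max (x - (1 - ε₃)) 0 = s at *
      generalize (∫ s in x..1, sol.ut t s) = P at *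
      generalize a 1 / β₁ * sol.η₁ t = r at *
      rw [abs_mul, abs_of_nonneg (sq_nonneg s)]
      have h2 : s ^ 2 * |(P + r) * sol.ux t x| ≤ 1 * |(P + r) * sol.ux t x| :=
        mul_le_mul_of_nonneg_right (by nlinarith) (abs_nonneg _)
      have h3 : |(P + r) * sol.ux t x| ≤ P ^ 2 + r ^ 2 + sol.ux t x ^ 2 := by
        rw [abs_le]
        constructor <;> nlinarith [sq_nonneg (P + r + sol.ux t x), sq_nonneg (P - r),
          sq_nonneg (P + r - sol.ux t x), sq_nonneg (sol.ux t x)]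
      linarith
  rw [intervalIntegral.integral_add intervalIntegrable_const
    (hU.intervalIntegrable_of_Icc zero_le_one), intervalIntegral.integral_const] at h
  refine h.trans ?_
  have h1 := sol.integral_sq_ut_nonneg t
  have h2 := sol.integral_sq_ux_nonneg t
  simp only [sub_zero, one_smul, stateNormSq]
  generalize (∫ x in (0:ℝ)..1, sol.ut t x ^ 2) = V at *
  generalize (∫ x in (0:ℝ)..1, sol.ux t x ^ 2) = U at *
  have h3 : 0 ≤ (a 1 / β₁) ^ 2 * (V + U + sol.η₂ t ^ 2 + sol.ζ₁ t ^ 2) + sol.η₁ t ^ 2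
    + sol.η₂ t ^ 2 + sol.ζ₁ t ^ 2 := by positivity
  nlinarith

theorem exists_abs_mul_momentum_le :
    ∃ K > 0, ∀ sol : ClassicalSolutionS a q α₁ α₂ β₁ γ₁ μ₁, ∀ t ≥ 0,
      |sol.η₂ t * sol.momentum t| ≤ K * sol.stateNormSq t := by
  refine ⟨2 + 2 * (a 1 / β₁) ^ 2 + 2 * (a 0 / μ₁) ^ 2, by positivity, fun sol t ht => ?_⟩
  have hW := sol.sq_integral_ut_le ht (left_mem_Icc.2 zero_le_one)
  have h1 := sol.integral_sq_ut_nonneg t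
  have h2 := sol.integral_sq_ux_nonneg t
  unfold momentum stateNormSq
  generalize (∫ x in (0:ℝ)..1, sol.ut t x) = W at *
  generalize (∫ x in (0:ℝ)..1, sol.ut t x ^ 2) = V at *
  generalize (∫ x in (0:ℝ)..1, sol.ux t x ^ 2) = U at *
  generalize a 1 / β₁ = b at *
  generalize a 0 / μ₁ = c at *
  generalize sol.η₁ t = x
  generalize sol.η₂ t = y
  generalize sol.ζ₁ t = z
  have h3 : |y * (W + b * x + c * z)| ≤ y ^ 2 + 2 * W ^ 2 + 2 * (b * x) ^ 2 + 2 * (c * z) ^ 2 := by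
    rw [abs_le]
    constructor <;> nlinarith [sq_nonneg (y + (W + b * x + c * z)),
      sq_nonneg (y - (W + b * x + c * z)), sq_nonneg (W - b * x), sq_nonneg (W - c * z),
      sq_nonneg (b * x - c * z), sq_nonneg W, sq_nonneg (b * x), sq_nonneg (c * z), sq_nonneg y]
  have h4 : 0 ≤ 2 * U + 2 * x ^ 2 + y ^ 2 + 2 * z ^ 2 + 2 * b ^ 2 * (V + U + y ^ 2 + z ^ 2)
    + 2 * c ^ 2 * (V + U + x ^ 2 + y ^ 2) := by positivity
  nlinarith

end Comparison

section Decay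

theorem exists_energyS_deriv_le (ha : AssumptionA1 a a_min a_max) (hq : AssumptionA2' q ε₃ q_min)
    (hα₁ : 0 < α₁) (hβ₁ : 0 < β₁) (hγ₁ : 0 < γ₁) (hμ₁ : 0 < μ₁) :
    ∃ c > 0, ∀ sol : ClassicalSolutionS a q α₁ α₂ β₁ γ₁ μ₁, ∀ t > 0,
      ∃ d, HasDerivAt (energyS sol) d t ∧ d ≤ -c * sol.dissipation t := by
  obtain ⟨-, hamin, -, hab⟩ := id ha
  have ha0 := hamin.trans_le (hab 0 (left_mem_Icc.2 zero_le_one)).1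
  have ha1 := hamin.trans_le (hab 1 (right_mem_Icc.2 zero_le_one)).1
  refine ⟨min 1 (min (a 1 * α₁ / β₁) (a 0 * γ₁ / μ₁)), by positivity, fun sol t ht =>
    ⟨_, sol.hasDerivAt_energyS ha hq hβ₁.ne' hμ₁.ne' ht, ?_⟩⟩
  have hD := SpatialSlice.integral_damping_nonneg hq (sol.ut t)
  obtain ⟨h1, h2, h3⟩ : min 1 (min (a 1 * α₁ / β₁) (a 0 * γ₁ / μ₁)) ≤ 1 ∧
      min 1 (min (a 1 * α₁ / β₁) (a 0 * γ₁ / μ₁)) ≤ a 1 * α₁ / β₁ ∧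
      min 1 (min (a 1 * α₁ / β₁) (a 0 * γ₁ / μ₁)) ≤ a 0 * γ₁ / μ₁ := by
    simpa only [le_min_iff] using le_refl (min 1 (min (a 1 * α₁ / β₁) (a 0 * γ₁ / μ₁)))
  unfold dissipation
  linarith [mul_le_mul_of_nonneg_right h1 hD, mul_le_mul_of_nonneg_right h2 (sq_nonneg (sol.η₁ t)),
    mul_le_mul_of_nonneg_right h3 (sq_nonneg (sol.ζ₁ t))]

theorem exists_fluxFunctional_deriv_le (ha : AssumptionA1 a a_min a_max)
    (hq : AssumptionA2' q ε₃ q_min) :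
    ∃ k > 0, ∃ c > 0, ∃ M > 0, ∃ C > 0, ∀ sol : ClassicalSolutionS a q α₁ α₂ β₁ γ₁ μ₁, ∀ t > 0,
      ∃ d, HasDerivAt (sol.fluxFunctional k) d t ∧
        d ≤ -c * ((∫ x in (0:ℝ)..1, sol.ut t x ^ 2) + ∫ x in (0:ℝ)..1, sol.ux t x ^ 2)
          + M * (∫ x in (0:ℝ)..1, max (x - (1 - ε₃)) 0 ^ 2 * sol.ux t x ^ 2)
          + C * sol.dissipation t := by
  obtain ⟨k, hk, c, hc, M, hM, C, hC, h⟩ := SpatialSlice.exists_flux_multiplier_le ha hq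
  refine ⟨k, hk, c, hc, M, hM, C, hC, fun sol t ht =>
    ⟨_, sol.hasDerivAt_fluxFunctional ha k ht, (h _ _ _ _ (sol.spatialSlice ht)).trans ?_⟩⟩
  gcongr
  unfold dissipation
  linarith [sq_nonneg (sol.η₁ t), sq_nonneg (sol.ζ₁ t)]

theorem exists_tailFunctional_deriv_le (ha : AssumptionA1 a a_min a_max)
    (hq : AssumptionA2' q ε₃ q_min) (hβ₁ : 0 < β₁) :
    ∃ c > 0, ∃ C > 0, ∀ sol : ClassicalSolutionS a q α₁ α₂ β₁ γ₁ μ₁, ∀ t > 0,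
      ∃ d, HasDerivAt (sol.tailFunctional ε₃) d t ∧
        d ≤ -c * (∫ x in (0:ℝ)..1, max (x - (1 - ε₃)) 0 ^ 2 * sol.ux t x ^ 2)
          + C * (sol.η₂ t ^ 2 + sol.dissipation t) := by
  obtain ⟨c, hc, C, hC, h⟩ := SpatialSlice.exists_tail_multiplier_le ha hq
  set b := a 1 / β₁ with hb
  refine ⟨c, hc, C * (2 + 2 * b ^ 2 * (α₁ ^ 2 + α₂ ^ 2) + b ^ 2), by positivity, fun sol t ht =>
    ⟨_, sol.hasDerivAt_tailFunctional hq hβ₁.ne' ht,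
      (h _ _ _ _ (sol.spatialSlice ht) _ _).trans ?_⟩⟩
  have hD := SpatialSlice.integral_damping_nonneg hq (sol.ut t)
  rw [sol.hbc1 t ht.le, ← hb, mul_assoc C]
  gcongr
  unfold dissipation
  generalize (∫ x in (0:ℝ)..1, q x * sol.ut t x ^ 2) = D at *
  generalize sol.η₁ t = x
  generalize sol.η₂ t = y
  generalize sol.ζ₁ t = z
  have h1 : (b * (α₁ * x + α₂ * y)) ^ 2 ≤ 2 * b ^ 2 * (α₁ ^ 2 + α₂ ^ 2) * (y ^ 2 + x ^ 2) := by
    have h2 : (α₁ * x + α₂ * y) ^ 2 ≤ (α₁ ^ 2 + α₂ ^ 2) * (y ^ 2 + x ^ 2) := by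
      nlinarith [sq_nonneg (α₁ * y - α₂ * x)]
    have h3 : 0 ≤ (α₁ ^ 2 + α₂ ^ 2) * (y ^ 2 + x ^ 2) := by positivity
    nlinarith [mul_le_mul_of_nonneg_left h2 (sq_nonneg b), mul_nonneg (sq_nonneg b) h3]
  have h4 : 0 ≤ 2 * b ^ 2 * (α₁ ^ 2 + α₂ ^ 2) * (D + z ^ 2) + b ^ 2 * (y ^ 2 + D + z ^ 2)
    + 2 * y ^ 2 + D + x ^ 2 + 2 * z ^ 2 := by positivity
  linarith

theorem exists_mul_momentum_deriv_le (ha : AssumptionA1 a a_min a_max)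
    (hq : AssumptionA2' q ε₃ q_min) (hα₂ : 0 < α₂) (hβ₁ : 0 < β₁) (hμ₁ : 0 < μ₁) :
    ∃ c > 0, ∃ C > 0, ∀ δ > 0, ∀ sol : ClassicalSolutionS a q α₁ α₂ β₁ γ₁ μ₁, ∀ t > 0,
      ∃ d, HasDerivAt (fun s => sol.η₂ s * sol.momentum s) d t ∧
        d ≤ -c * sol.η₂ t ^ 2 + δ * (∫ x in (0:ℝ)..1, sol.ut t x ^ 2)
          + (C + 1 / δ) * sol.dissipation t := by
  obtain ⟨Q, hQ, hR⟩ := SpatialSlice.exists_sq_integral_damping_le hq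
  obtain ⟨-, hamin, -, hab⟩ := id ha
  have ha1 := hamin.trans_le (hab 1 (right_mem_Icc.2 zero_le_one)).1
  have hb0 : 0 < a 1 / β₁ := by positivity
  set b := a 1 / β₁ with hb
  set g := a 0 / μ₁ with hg
  set m := b * α₂ / 2 with hm
  have hm0 : 0 < m := by positivity
  refine ⟨m, hm0, b + g ^ 2 + 1 + 3 / m * (Q + (b * α₁) ^ 2 + (g * γ₁) ^ 2), by positivity,
    fun δ hδ sol t ht =>
      ⟨_, (sol.hode2 t ht.le).mul (sol.hasDerivAt_momentum hq hβ₁.ne' hμ₁.ne' ht), ?_⟩⟩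
  have hD := SpatialSlice.integral_damping_nonneg hq (sol.ut t)
  have hr := hR _ (continuousOn_slice sol.continuousOn_ut ht.le) 0 (left_mem_Icc.2 zero_le_one)
  have hW := sol.sq_integral_ut_le ht.le (left_mem_Icc.2 zero_le_one)
  unfold momentum dissipation
  rw [← hb, ← hg]
  generalize (∫ x in (0:ℝ)..1, sol.ut t x) = W at *
  generalize (∫ x in (0:ℝ)..1, sol.ut t x ^ 2) = V at *
  generalize (∫ x in (0:ℝ)..1, q x * sol.ut t x ^ 2) = D at *
  generalize (∫ x in (0:ℝ)..1, q x * sol.ut t x) = R at *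
  generalize sol.η₁ t = x
  generalize sol.η₂ t = y
  generalize sol.ζ₁ t = z
  have h1 : x * W ≤ δ * W ^ 2 + 1 / δ * x ^ 2 := by
    have h2 : δ * W ^ 2 + 1 / δ * x ^ 2 - x * W =
        ((δ * W - x / 2) ^ 2 + 3 / 4 * x ^ 2) / δ := by
      field_simp
      ring
    have h3 : 0 ≤ ((δ * W - x / 2) ^ 2 + 3 / 4 * x ^ 2) / δ := by positivity
    linarith
  have h4 : δ * W ^ 2 ≤ δ * V := mul_le_mul_of_nonneg_left hW hδ.le
  have h5 : x * (g * z) ≤ x ^ 2 + g ^ 2 * z ^ 2 := by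
    nlinarith [sq_nonneg (x - g * z), sq_nonneg (x + g * z)]
  have h6 : -(y * (R + b * α₁ * x + g * γ₁ * z)) ≤
      m * y ^ 2 + 3 / m * (R ^ 2 + (b * α₁) ^ 2 * x ^ 2 + (g * γ₁) ^ 2 * z ^ 2) := by
    have h7 : (R + b * α₁ * x + g * γ₁ * z) ^ 2 ≤
        3 * (R ^ 2 + (b * α₁) ^ 2 * x ^ 2 + (g * γ₁) ^ 2 * z ^ 2) := by
      nlinarith [sq_nonneg (R - b * α₁ * x), sq_nonneg (R - g * γ₁ * z),
        sq_nonneg (b * α₁ * x - g * γ₁ * z)]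
    generalize R + b * α₁ * x + g * γ₁ * z = r at *
    have h8 : m * y ^ 2 + r ^ 2 / m + y * r = ((m * y + r / 2) ^ 2 + 3 / 4 * r ^ 2) / m := by
      field_simp
      ring
    have h9 : 0 ≤ ((m * y + r / 2) ^ 2 + 3 / 4 * r ^ 2) / m := by positivity
    have h10 : r ^ 2 / m ≤
        3 * (R ^ 2 + (b * α₁) ^ 2 * x ^ 2 + (g * γ₁) ^ 2 * z ^ 2) / m := by gcongr
    have h11 : 3 * (R ^ 2 + (b * α₁) ^ 2 * x ^ 2 + (g * γ₁) ^ 2 * z ^ 2) / m =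
      3 / m * (R ^ 2 + (b * α₁) ^ 2 * x ^ 2 + (g * γ₁) ^ 2 * z ^ 2) := by ring
    linarith
  have h12 : 3 / m * R ^ 2 ≤ 3 / m * (Q * D) := mul_le_mul_of_nonneg_left hr (by positivity)
  have h13 : b * α₂ = 2 * m := by rw [hm]; ring
  have h14 : 0 ≤ (b + g ^ 2 + 1) * D + b * z ^ 2 + g ^ 2 * x ^ 2 + z ^ 2
    + 3 / m * (Q * (x ^ 2 + z ^ 2) + (b * α₁) ^ 2 * (D + z ^ 2) + (g * γ₁) ^ 2 * (D + x ^ 2))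
    + 1 / δ * (D + z ^ 2) := by positivity
  have h15 : y * (b * α₂ * y) = 2 * m * y ^ 2 := by rw [h13]; ring
  linarith

end Decay

end ClassicalSolutionS

/-- Integral observability inequality: `∫_S^T E(t) dt ≤ C E(S)` for every `0 ≤ S ≤ T`, with a
constant `C` independent of the solution and of `S, T`. -/
theorem integral_observability_S (a q : ℝ → ℝ)
    (a_min a_max ε₃ q_min α₁ α₂ β₁ γ₁ μ₁ : ℝ)
    (hA1 : AssumptionA1 a a_min a_max) (hA2 : AssumptionA2' q ε₃ q_min)
    (hα₁ : 0 < α₁) (hα₂ : 0 < α₂) (hβ₁ : 0 < β₁) (hγ₁ : 0 < γ₁) (hμ₁ : 0 < μ₁) :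
    ∃ C > (0:ℝ), ∀ sol : ClassicalSolutionS a q α₁ α₂ β₁ γ₁ μ₁,
      ∀ S T : ℝ, 0 ≤ S → S ≤ T →
        (∫ t in S..T, energyS sol t) ≤ C * energyS sol S := by
  obtain ⟨-, -, -, hε, hε1, -, -⟩ := id hA2
  obtain ⟨e, he, K, hK, hE⟩ :=
    ClassicalSolutionS.exists_stateNormSq_le_energyS_le (q := q) (α₁ := α₁) (γ₁ := γ₁) hA1 hα₂ hβ₁ hμ₁
  obtain ⟨c₀, hc₀, h₀⟩ :=
    ClassicalSolutionS.exists_energyS_deriv_le (α₂ := α₂) hA1 hA2 hα₁ hβ₁ hγ₁ hμ₁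
  obtain ⟨k, hk, c₁, hc₁, M, hM, C₁, hC₁, h₁⟩ :=
    ClassicalSolutionS.exists_fluxFunctional_deriv_le (α₁ := α₁) (α₂ := α₂) (β₁ := β₁) (γ₁ := γ₁)
      (μ₁ := μ₁) hA1 hA2
  obtain ⟨c₂, hc₂, C₂, hC₂, h₂⟩ :=
    ClassicalSolutionS.exists_tailFunctional_deriv_le (α₁ := α₁) (α₂ := α₂) (γ₁ := γ₁)
      (μ₁ := μ₁) hA1 hA2 hβ₁
  obtain ⟨c₃, hc₃, C₃, hC₃, h₃⟩ :=
    ClassicalSolutionS.exists_mul_momentum_deriv_le (α₁ := α₁) (γ₁ := γ₁) hA1 hA2 hα₂ hβ₁ hμ₁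
  obtain ⟨K₁, hK₁, hF₁⟩ := ClassicalSolutionS.exists_abs_fluxFunctional_le (q := q) (α₁ := α₁)
    (α₂ := α₂) (β₁ := β₁) (γ₁ := γ₁) (μ₁ := μ₁) hA1 hk.le
  obtain ⟨K₂, hK₂, hF₂⟩ := ClassicalSolutionS.exists_abs_tailFunctional_le (a := a) (q := q)
    (α₁ := α₁) (α₂ := α₂) (β₁ := β₁) (γ₁ := γ₁) (μ₁ := μ₁) hε hε1
  obtain ⟨K₃, hK₃, hF₃⟩ := ClassicalSolutionS.exists_abs_mul_momentum_le (a := a) (q := q)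
    (α₁ := α₁) (α₂ := α₂) (β₁ := β₁) (γ₁ := γ₁) (μ₁ := μ₁)
  set m₂ := M / c₂ with hm₂
  have hm₂0 : 0 < m₂ := by positivity
  set m₃ := (m₂ * C₂ + 1) / c₃ with hm₃
  have hm₃0 : 0 < m₃ := by positivity
  set δ := c₁ / (2 * m₃) with hδ
  have hδ0 : 0 < δ := by positivity
  specialize h₃ δ hδ0
  set B := C₁ + m₂ * C₂ + m₃ * (C₃ + 1 / δ) + 1 with hB
  have hB0 : 0 < B := by positivity
  set R := K₁ + m₂ * K₂ + m₃ * K₃ with hR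
  have hR0 : 0 < R := by positivity
  set N := B / c₀ + R / e with hN
  have hN0 : 0 < N := by positivity
  have e2 : m₂ * c₂ = M := by rw [hm₂]; field_simp
  have e3 : m₃ * c₃ = m₂ * C₂ + 1 := by rw [hm₃]; field_simp
  have eδ : m₃ * δ = c₁ / 2 := by rw [hδ]; field_simp
  have hNc : B ≤ N * c₀ := by
    have : N * c₀ = B + R / e * c₀ := by rw [hN]; field_simp
    have : 0 < R / e * c₀ := by positivity
    linarith
  have hNe : R ≤ N * e := by
    have : N * e = B / c₀ * e + R := by rw [hN]; field_simp
    have : 0 < B / c₀ * e := by positivity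
    linarith
  obtain ⟨κ, hκ, hκ1, hκ2⟩ : ∃ κ > 0, κ ≤ 1 ∧ κ ≤ c₁ / 2 :=
    ⟨min 1 (c₁ / 2), by positivity, min_le_left _ _, min_le_right _ _⟩
  refine ⟨(N + R / e) / (κ / K), by positivity, fun sol S T hS hST => ?_⟩
  have hcE := sol.continuousOn_energyS hA1
  have hF : ∀ t ≥ 0, |sol.fluxFunctional k t + m₂ * sol.tailFunctional ε₃ t
      + m₃ * (sol.η₂ t * sol.momentum t)| ≤ R * sol.stateNormSq t := fun t ht => by
    have a1 := abs_le.1 (hF₁ sol t ht)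
    have a2 := abs_le.1 (hF₂ sol t ht)
    have a3 := abs_le.1 (hF₃ sol t ht)
    rw [abs_le, hR]
    constructor
    · linarith [mul_le_mul_of_nonneg_left a2.1 hm₂0.le, mul_le_mul_of_nonneg_left a3.1 hm₃0.le]
    · linarith [mul_le_mul_of_nonneg_left a2.2 hm₂0.le, mul_le_mul_of_nonneg_left a3.2 hm₃0.le]
  choose! d₀ hd₀ hd₀' using h₀ sol
  choose! d₁ hd₁ hd₁' using h₁ sol
  choose! d₂ hd₂ hd₂' using h₂ sol
  choose! d₃ hd₃ hd₃' using h₃ sol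
  have key := mul_integral_le_of_hasDerivAt_le (κ := κ / K) (S := S) (T := T)
    (L := fun t => N * energyS sol t + (sol.fluxFunctional k t + m₂ * sol.tailFunctional ε₃ t
      + m₃ * (sol.η₂ t * sol.momentum t)))
    (L' := fun t => N * d₀ t + (d₁ t + m₂ * d₂ t + m₃ * d₃ t))
    ((hcE.const_mul N).add (((sol.continuousOn_fluxFunctional hA1 k).add
      ((sol.continuousOn_tailFunctional ε₃).const_mul m₂)).add
      ((sol.hη₂C1.continuousOn.mul sol.continuousOn_momentum).const_mul m₃))) hcE
    (fun t ht => ((hd₀ t ht).const_mul N).add (((hd₁ t ht).add ((hd₂ t ht).const_mul m₂)).add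
      ((hd₃ t ht).const_mul m₃))) (fun t ht => ?_) hS hST ?_
  · rw [div_mul_eq_mul_div, le_div_iff₀ (by positivity), mul_comm]
    refine key.trans ?_
    have h1 := (abs_le.1 (hF S hS)).2
    have h2 : R * sol.stateNormSq S ≤ R / e * energyS sol S := by
      rw [div_mul_eq_mul_div, le_div_iff₀ he]
      linarith [mul_le_mul_of_nonneg_left (hE sol S hS).1 hR0.le]
    linarith
  · have b0 := mul_le_mul_of_nonneg_left (hd₀' t ht) hN0.le
    have b1 := hd₁' t ht
    have b2 := mul_le_mul_of_nonneg_left (hd₂' t ht) hm₂0.le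
    have b3 := mul_le_mul_of_nonneg_left (hd₃' t ht) hm₃0.le
    have hDq := SpatialSlice.integral_damping_nonneg hA2 (sol.ut t)
    have hx := sq_nonneg (sol.η₁ t)
    have hy := sq_nonneg (sol.η₂ t)
    have hz := sq_nonneg (sol.ζ₁ t)
    have hV := sol.integral_sq_ut_nonneg t
    have hU := sol.integral_sq_ux_nonneg t
    have hKE : κ / K * energyS sol t ≤ κ * sol.stateNormSq t := by
      rw [div_mul_eq_mul_div, div_le_iff₀ hK]
      linarith [mul_le_mul_of_nonneg_left (hE sol t ht.le).2 hκ.le]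
    have hD : sol.η₁ t ^ 2 + sol.ζ₁ t ^ 2 ≤ sol.dissipation t := by
      unfold ClassicalSolutionS.dissipation
      linarith
    have hZ : κ * sol.stateNormSq t ≤ c₁ / 2 * ((∫ x in (0:ℝ)..1, sol.ut t x ^ 2)
        + ∫ x in (0:ℝ)..1, sol.ux t x ^ 2) + sol.η₁ t ^ 2 + sol.η₂ t ^ 2 + sol.ζ₁ t ^ 2 := by
      unfold ClassicalSolutionS.stateNormSq
      linarith [mul_le_mul_of_nonneg_right hκ2 hV, mul_le_mul_of_nonneg_right hκ2 hU,
        mul_le_mul_of_nonneg_right hκ1 hx, mul_le_mul_of_nonneg_right hκ1 hy,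
        mul_le_mul_of_nonneg_right hκ1 hz]
    generalize (∫ x in (0:ℝ)..1, sol.ut t x ^ 2) = V at *
    generalize (∫ x in (0:ℝ)..1, sol.ux t x ^ 2) = U at *
    generalize (∫ x in (0:ℝ)..1, max (x - (1 - ε₃)) 0 ^ 2 * sol.ux t x ^ 2) = W at *
    generalize sol.dissipation t = D at *
    have hND := mul_le_mul_of_nonneg_right hNc (show 0 ≤ D by linarith)
    have f2 : m₂ * (-c₂ * W + C₂ * (sol.η₂ t ^ 2 + D)) =
        -M * W + m₂ * C₂ * sol.η₂ t ^ 2 + m₂ * C₂ * D := by rw [← e2]; ring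
    have f3 : m₃ * (-c₃ * sol.η₂ t ^ 2 + δ * V + (C₃ + 1 / δ) * D) =
        -(m₃ * c₃) * sol.η₂ t ^ 2 + m₃ * δ * V + m₃ * (C₃ + 1 / δ) * D := by ring
    rw [e3, eδ] at f3
    have fB : B * D = C₁ * D + m₂ * C₂ * D + m₃ * (C₃ + 1 / δ) * D + D := by rw [hB]; ring
    have fU : 0 ≤ c₁ / 2 * U := by positivity
    linarith
  · have hT := hS.trans hST
    have h1 := (abs_le.1 (hF T hT)).1
    have h2 := mul_le_mul_of_nonneg_left (hE sol T hT).1 hN0.le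
    have h3 := mul_le_mul_of_nonneg_right hNe (sol.stateNormSq_nonneg T)
    linarith
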